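/- arXiv:0812.4673 — 3 statements merged into one kernel-verified Lean document; each statement's English description precedes it below -/
import Mathlib

section
/- Let H be a Hilbert space, η > 0, I a bounded closed interval of ℝ, and C : I ⇉ H a set-valued map with closed η-prox-regular values that varies in an absolutely continuous way: there exists an absolutely continuous function w : I → ℝ such that |d(y,C(t)) − d(y,C(s))| ≤ |w(t) − w(s)| for all y ∈ H and s,t ∈ I. Let f : I × H → H be measurable in the first variable, continuous in the second, satisfy ‖f(t,x)‖ ≤ β(t)(1 + ‖x‖) for some nonnegative β ∈ L¹(I,ℝ), for all t ∈ I and x ∈ ∪_{s∈I} C(s), and satisfy a Lipschitz condition: for every M > 0 there is a nonnegative k_M ∈ L¹(I,ℝ) with ‖f(t,x) − f(t,y)‖ ≤ k_M(t)‖x − y‖ for all t ∈ I and x,y ∈ B(0,M). Then for every u₀ ∈ C(0), the sweeping process u̇(t) + N(C(t),u(t)) ∋ f(t,u(t)) a.e. t ∈ I, u(0) = u₀, u(t) ∈ C(t), has one and only one absolutely continuous solution. -/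
open MeasureTheory Set Filter Topology

noncomputable section

/-- The (set-valued) metric projection onto `C`:
`P_C(y) = {z ∈ C | ‖y - z‖ = d(y,C)}`. -/
def projSet {E : Type*} [NormedAddCommGroup E] (C : Set E) (y : E) : Set E :=
  {z | z ∈ C ∧ ‖y - z‖ = Metric.infDist y C}

/-- The proximal normal cone of `C` at `x`:
`N(C,x) = {v | ∃ s > 0, x ∈ P_C(x + s v)}`. -/
def proxNormalCone {E : Type*} [NormedAddCommGroup E] [NormedSpace ℝ E]
    (C : Set E) (x : E) : Set E :=
  {v | ∃ s : ℝ, 0 < s ∧ x ∈ projSet C (x + s • v)}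

/-- `C` is `η`-prox-regular: for every `x ∈ C` and every nonzero proximal normal `v`,
the open ball `B(x + η v/‖v‖, η)` does not meet `C`. -/
def ProxRegular {E : Type*} [NormedAddCommGroup E] [NormedSpace ℝ E]
    (η : ℝ) (C : Set E) : Prop :=
  ∀ x ∈ C, ∀ v ∈ proxNormalCone C x, v ≠ 0 →
    Metric.ball (x + (η * ‖v‖⁻¹) • v) η ∩ C = ∅

/-- An absolutely continuous solution of the sweeping process
`u̇(t) + N(C(t),u(t)) ∋ f(t,u(t))`, `u(0) = u₀`, on `[0,T]`: `u` is absolutely continuous,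
i.e. `u(t) = u₀ + ∫₀ᵗ g` for some Bochner-integrable density `g` (`g = u̇` a.e.),
`u(t) ∈ C(t)` for all `t ∈ [0,T]` and `f(t,u(t)) - u̇(t) ∈ N(C(t),u(t))` a.e. on `[0,T]`. -/
def IsSweepingSol {E : Type*} [NormedAddCommGroup E] [NormedSpace ℝ E] [CompleteSpace E]
    (C : ℝ → Set E) (f : ℝ → E → E) (T : ℝ) (u₀ : E) (u : ℝ → E) : Prop :=
  ∃ g : ℝ → E, IntegrableOn g (Set.Icc 0 T) ∧
    (∀ t ∈ Set.Icc (0:ℝ) T, u t = u₀ + ∫ s in (0:ℝ)..t, g s) ∧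
    (∀ t ∈ Set.Icc (0:ℝ) T, u t ∈ C t) ∧
    (∀ᵐ t ∂volume.restrict (Set.Icc (0:ℝ) T),
      f t (u t) - g t ∈ proxNormalCone (C t) (u t))

/-- A function is absolutely continuous on `[a,b]` iff it is an indefinite integral of an
integrable function. -/
def IsAbsContOn (w : ℝ → ℝ) (a b : ℝ) : Prop :=
  ∃ g : ℝ → ℝ, IntegrableOn g (Set.Icc a b) ∧
    ∀ t ∈ Set.Icc a b, w t = w a + ∫ s in a..t, g s

open scoped RealInnerProductSpace

/-- Dependent choice along `ℕ`, with an invariant `Q` and a step relation `R`. -/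
theorem exists_seq_of_step {α : Type*} {Q : ℕ → α → Prop} {R : ℕ → α → α → Prop} {a : α}
    (h0 : Q 0 a) (step : ∀ n x, Q n x → ∃ y, Q (n + 1) y ∧ R n x y) :
    ∃ s : ℕ → α, s 0 = a ∧ ∀ n, Q n (s n) ∧ R n (s n) (s (n + 1)) := by
  choose F hFQ hFR using step
  let S : ∀ n, {x // Q n x} := fun n =>
    Nat.rec ⟨a, h0⟩ (fun n x => ⟨F n x.1 x.2, hFQ n x.1 x.2⟩) n
  exact ⟨fun n => (S n).1, rfl, fun n => ⟨(S n).2, hFR n _ (S n).2⟩⟩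

section Geometry

variable {H : Type*} [NormedAddCommGroup H] [InnerProductSpace ℝ H]

theorem ProxRegular.inner_le {η : ℝ} (hη : 0 < η) {C : Set H} (hC : ProxRegular η C) {x v z : H}
    (hx : x ∈ C) (hv : v ∈ proxNormalCone C x) (hz : z ∈ C) :
    ⟪v, z - x⟫ ≤ ‖v‖ / (2 * η) * ‖z - x‖ ^ 2 := by
  rcases eq_or_ne v 0 with rfl | hv0
  · simp
  have hvn : 0 < ‖v‖ := norm_pos_iff.mpr hv0
  have hball : z ∉ Metric.ball (x + (η * ‖v‖⁻¹) • v) η := fun h => by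
    have := hC x hx v hv hv0
    exact (this ▸ (⟨h, hz⟩ : z ∈ _ ∩ C) : z ∈ (∅ : Set H))
  rw [Metric.mem_ball, not_lt, dist_eq_norm, ← sub_sub] at hball
  have h2 : η ^ 2 ≤ ‖z - x - (η * ‖v‖⁻¹) • v‖ ^ 2 := by gcongr
  rw [norm_sub_sq_real, norm_smul, inner_smul_right, real_inner_comm, Real.norm_of_nonneg
    (by positivity), mul_assoc, mul_assoc, inv_mul_cancel₀ hvn.ne', mul_one] at h2
  have h3 : 2 * (η * ‖v‖⁻¹ * ⟪v, z - x⟫) ≤ ‖z - x‖ ^ 2 := by rw [mul_assoc]; linarith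
  have h4 : ⟪v, z - x⟫ = ‖v‖ / (2 * η) * (2 * (η * ‖v‖⁻¹ * ⟪v, z - x⟫)) := by
    field_simp
  rw [h4]
  gcongr

theorem mem_proxNormalCone_of_inner_le {C : Set H} {x v : H} {c : ℝ} (hc : 0 < c) (hx : x ∈ C)
    (h : ∀ z ∈ C, ⟪v, z - x⟫ ≤ c * ‖z - x‖ ^ 2) : v ∈ proxNormalCone C x := by
  refine ⟨(2 * c)⁻¹, by positivity, hx, ?_⟩
  refine le_antisymm ((Metric.le_infDist (s := C) ⟨x, hx⟩).mpr fun z hz => ?_)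
    (dist_eq_norm (x + (2 * c)⁻¹ • v) x ▸ Metric.infDist_le_dist_of_mem hx)
  rw [dist_eq_norm, add_sub_cancel_left]
  refine (pow_le_pow_iff_left₀ (norm_nonneg ((2 * c)⁻¹ • v)) (norm_nonneg (x + (2 * c)⁻¹ • v - z))
    two_ne_zero).mp ?_
  rw [show x + (2 * c)⁻¹ • v - z = (2 * c)⁻¹ • v - (z - x) by abel,
    norm_sub_sq_real, inner_smul_left]
  have h1 := mul_le_mul_of_nonneg_left (h z hz) (show 0 ≤ 2 * (2 * c)⁻¹ by positivity)
  have h2 : 2 * (2 * c)⁻¹ * (c * ‖z - x‖ ^ 2) = ‖z - x‖ ^ 2 := by field_simp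
  simp only [conj_trivial]
  linarith

theorem projSet_sub_mem_proxNormalCone {C : Set H} {x y : H} (h : x ∈ projSet C y) :
    y - x ∈ proxNormalCone C x :=
  ⟨1, one_pos, by simpa using h⟩

theorem norm_add_smul_sub_sq (a b : H) (k : ℝ) :
    ‖a + k • (b - a)‖ ^ 2 = (1 - k) * ‖a‖ ^ 2 + k * ‖b‖ ^ 2 - k * (1 - k) * ‖b - a‖ ^ 2 := by
  rw [norm_add_sq_real, inner_smul_right, inner_sub_right, norm_smul, mul_pow,
    norm_sub_sq_real b a, real_inner_self_eq_norm_sq, real_inner_comm a b, Real.norm_eq_abs, sq_abs]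
  ring

/-- Points with a nearest point in a closed set are dense in a Hilbert space. -/
theorem exists_mem_projSet_near [CompleteSpace H] {C : Set H} (hC : IsClosed C) (hne : C.Nonempty)
    (y : H) {ε : ℝ} (hε : 0 < ε) : ∃ y' x, dist y y' ≤ ε ∧ x ∈ projSet C y' := by
  obtain ⟨x₀, hx₀⟩ := hne
  have hne : C.Nonempty := ⟨x₀, hx₀⟩
  -- a near minimiser no farther than a given point
  have hnear : ∀ y : H, ∀ x ∈ C, ∀ δ > 0, ∃ x' ∈ C, dist y x' ≤ dist y x ∧
      dist y x' ≤ Metric.infDist y C + δ := by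
    intro y x hx δ hδ
    by_cases hxd : dist y x ≤ Metric.infDist y C + δ
    · exact ⟨x, hx, le_rfl, hxd⟩
    · obtain ⟨x', hx', h⟩ := (Metric.infDist_lt_iff hne).mp (lt_add_of_pos_right _ hδ)
      exact ⟨x', hx', by linarith, h.le⟩
  set r : ℝ := dist y x₀ + 1 with hr
  have hr0 : 0 < r := by positivity
  set κ : ℝ := min 1 (ε / r) with hκ
  have hκ0 : 0 < κ := by positivity
  have hκr : κ * r ≤ ε := by
    calc κ * r ≤ ε / r * r := by gcongr; exact min_le_right _ _
      _ = ε := by field_simp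
  let k : ℕ → ℝ := fun n => κ / 2 / 2 ^ n
  have hk0 : ∀ n, 0 < k n := fun n => by positivity
  have hk1 : ∀ n, k n ≤ 1 / 2 := fun n => by
    have h1 : κ / 2 ≤ 1 / 2 := by have := min_le_left 1 (ε / r); linarith
    exact (div_le_self (by positivity) (one_le_pow₀ (by norm_num))).trans h1
  obtain ⟨x₁, hx₁, hx₁r, hx₁d⟩ := hnear y x₀ hx₀ (k 0 ^ 3 / (2 * r))
    (by have := hk0 0; positivity)
  obtain ⟨s, hs0, hs⟩ := exists_seq_of_step (a := (y, x₁))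
    (Q := fun n p => p.2 ∈ C ∧ dist p.1 p.2 ≤ r ∧
      dist p.1 p.2 ≤ Metric.infDist p.1 C + k n ^ 3 / (2 * r))
    (R := fun n p q => dist p.1 q.1 ≤ κ * r / 2 / 2 ^ n ∧ dist p.2 q.2 ≤ κ / 2 / 2 ^ n)
    ⟨hx₁, by simp only; linarith, hx₁d⟩ (by
      rintro n ⟨y, x⟩ ⟨hx, hxr, hxd⟩
      simp only at hx hxr hxd
      have hkn := hk0 n
      have hkn1 := hk1 n
      set y' := y + k n • (x - y) with hy'
      obtain ⟨x', hx', hx'1, hx'2⟩ := hnear y' x hx (k (n + 1) ^ 3 / (2 * r))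
        (by have := hk0 (n + 1); positivity)
      have hy'x : dist y' x = (1 - k n) * dist y x := by
        rw [dist_eq_norm, dist_eq_norm,
          show y' - x = (1 - k n) • (y - x) by rw [hy']; module, norm_smul,
          Real.norm_of_nonneg (by linarith)]
      refine ⟨(y', x'), ⟨hx', ?_, hx'2⟩, ?_, ?_⟩
      · simp only
        nlinarith [dist_nonneg (x := y) (y := x)]
      · have h1 : dist y y' = k n * dist y x := by
          rw [dist_eq_norm, dist_eq_norm, show y - y' = k n • (y - x) by rw [hy']; module,
            norm_smul, Real.norm_of_nonneg hkn.le]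
        calc dist y y' = k n * dist y x := h1
          _ ≤ k n * r := by gcongr
          _ = κ * r / 2 / 2 ^ n := by simp only [k]; ring
      · have h1 : ‖y' - x'‖ ^ 2 ≤ ‖y' - x‖ ^ 2 := by
          rw [← dist_eq_norm, ← dist_eq_norm]; gcongr
        have h2 : ‖y' - x'‖ ^ 2 = (1 - k n) * ‖y - x'‖ ^ 2 + k n * ‖x - x'‖ ^ 2
            - k n * (1 - k n) * ‖x - y‖ ^ 2 := by
          rw [show y' - x' = (y - x') + k n • ((x - x') - (y - x')) by rw [hy']; module,
            norm_add_smul_sub_sq, sub_sub_sub_cancel_right]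
        have h3 : ‖y' - x‖ ^ 2 = (1 - k n) ^ 2 * ‖x - y‖ ^ 2 := by
          rw [← dist_eq_norm, hy'x, mul_pow, dist_comm, dist_eq_norm]
        have h4 : Metric.infDist y C ≤ ‖y - x'‖ :=
          dist_eq_norm y x' ▸ Metric.infDist_le_dist_of_mem hx'
        rw [dist_comm, dist_eq_norm] at hxr hxd
        have h5 : ‖x - y‖ ^ 2 - ‖y - x'‖ ^ 2 ≤ k n ^ 3 := by
          have h6 : ‖x - y‖ - ‖y - x'‖ ≤ k n ^ 3 / (2 * r) := by linarith
          have h7 : k n ^ 3 / (2 * r) * (2 * r) = k n ^ 3 := by field_simp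
          by_cases h8 : ‖y - x'‖ ≤ ‖x - y‖
          · have h9 : (‖x - y‖ - ‖y - x'‖) * (‖x - y‖ + ‖y - x'‖) ≤
                k n ^ 3 / (2 * r) * (2 * r) := by
              gcongr
              linarith
            linarith
          · have : ‖x - y‖ ^ 2 ≤ ‖y - x'‖ ^ 2 := by
              gcongr; linarith
            have : 0 ≤ k n ^ 3 := by positivity
            linarith
        have h6 : k n * ‖x - x'‖ ^ 2 ≤ k n * k n ^ 2 := by
          have : (1 - k n) * (‖x - y‖ ^ 2 - ‖y - x'‖ ^ 2) ≤ 1 * k n ^ 3 :=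
            (mul_le_mul_of_nonneg_left h5 (by linarith)).trans
              (mul_le_mul_of_nonneg_right (by linarith) (by positivity))
          nlinarith
        rw [dist_eq_norm]
        exact (pow_le_pow_iff_left₀ (norm_nonneg _) hkn.le two_ne_zero).mp
          (le_of_mul_le_mul_left h6 hkn))
  have hy_step := fun n => (hs n).2.1
  have hx_step := fun n => (hs n).2.2
  obtain ⟨y', hy'⟩ := cauchySeq_tendsto_of_complete (cauchySeq_of_le_geometric_two hy_step)
  obtain ⟨x', hx'⟩ := cauchySeq_tendsto_of_complete (cauchySeq_of_le_geometric_two hx_step)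
  have hx'C : x' ∈ C := hC.mem_of_tendsto hx' (Eventually.of_forall fun n => (hs n).1.1)
  refine ⟨y', x', ?_, hx'C, ?_⟩
  · have := dist_le_of_le_geometric_two_of_tendsto₀ hy_step hy'
    rw [hs0] at this
    exact this.trans hκr
  · rw [← dist_eq_norm]
    refine le_antisymm ?_ (Metric.infDist_le_dist_of_mem hx'C)
    have hk : Tendsto k atTop (𝓝 0) := by
      have := (tendsto_pow_atTop_nhds_zero_of_lt_one (r := (1 / 2 : ℝ)) (by norm_num)
        (by norm_num)).const_mul (κ / 2)
      rw [mul_zero] at this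
      refine this.congr fun n => ?_
      simp only [k]
      rw [div_pow, one_pow, mul_one_div]
    have hlim : Tendsto (fun n => Metric.infDist (s n).1 C + k n ^ 3 / (2 * r)) atTop
        (𝓝 (Metric.infDist y' C + 0 ^ 3 / (2 * r))) :=
      (((Metric.continuous_infDist_pt C).tendsto y').comp hy').add ((hk.pow 3).div_const _)
    have := le_of_tendsto_of_tendsto' (hy'.dist hx') hlim fun n => (hs n).1.2.2
    simpa using this

theorem ProxRegular.exists_mem_projSet [CompleteSpace H] {η : ℝ} (hη : 0 < η) {C : Set H}
    (hpr : ProxRegular η C) (hC : IsClosed C) (hne : C.Nonempty) {y : H}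
    (hy : Metric.infDist y C < η) : ∃ x, x ∈ projSet C y := by
  set θ := η - Metric.infDist y C with hθ
  have hθ0 : 0 < θ := by linarith
  have hseq : ∀ n : ℕ, ∃ y' x, dist y y' ≤ θ / 2 / 2 ^ n ∧ x ∈ projSet C y' := fun n =>
    exists_mem_projSet_near hC hne y (by positivity)
  choose Y X hY hX using hseq
  have hpow : Tendsto (fun n : ℕ => θ / 2 / 2 ^ n) atTop (𝓝 0) := by
    have := (tendsto_pow_atTop_nhds_zero_of_lt_one (r := (1 / 2 : ℝ)) (by norm_num)
      (by norm_num)).const_mul (θ / 2)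
    rw [mul_zero] at this
    refine this.congr fun n => ?_
    rw [div_pow, one_pow, mul_one_div]
  have hYlim : Tendsto Y atTop (𝓝 y) := by
    rw [tendsto_iff_dist_tendsto_zero]
    exact squeeze_zero (fun _ => dist_nonneg) (fun n => dist_comm y (Y n) ▸ hY n) hpow
  have hd : ∀ n, ‖Y n - X n‖ ≤ η - θ / 2 := fun n => by
    rw [(hX n).2]
    have h1 := Metric.infDist_le_infDist_add_dist (s := C) (x := Y n) (y := y)
    have h2 : θ / 2 / 2 ^ n ≤ θ / 2 := div_le_self (by positivity) (one_le_pow₀ (by norm_num))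
    have h3 := hY n
    rw [dist_comm] at h1
    linarith
  have hXY : ∀ n m, ‖X n - X m‖ ≤ 2 * η / θ * ‖Y n - Y m‖ := fun n m => by
    have h1 := hpr.inner_le hη (hX n).1 (projSet_sub_mem_proxNormalCone (hX n)) (hX m).1
    have h2 := hpr.inner_le hη (hX m).1 (projSet_sub_mem_proxNormalCone (hX m)) (hX n).1
    have h3 : ∀ n, ‖Y n - X n‖ / (2 * η) * ‖X n - X m‖ ^ 2 ≤
        (η - θ / 2) / (2 * η) * ‖X n - X m‖ ^ 2 := fun n => by
      gcongr
      exact hd n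
    have h3' : ∀ k, ‖Y k - X k‖ / (2 * η) * ‖X n - X m‖ ^ 2 ≤
        (η - θ / 2) / (2 * η) * ‖X n - X m‖ ^ 2 := fun k => by
      gcongr
      exact hd k
    have h4 := h3' n
    have h5 := h3' m
    rw [norm_sub_rev (X m)] at h1
    have h6 : ⟪Y n - X n, X m - X n⟫ + ⟪Y m - X m, X n - X m⟫ =
        ‖X n - X m‖ ^ 2 - ⟪Y n - Y m, X n - X m⟫ := by
      rw [← real_inner_self_eq_norm_sq, ← inner_sub_left, ← neg_sub (X n) (X m), inner_neg_right,
        ← sub_eq_neg_add, ← inner_sub_left]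
      congr 1
      abel
    have h7 : ⟪Y n - Y m, X n - X m⟫ ≤ ‖Y n - Y m‖ * ‖X n - X m‖ := real_inner_le_norm _ _
    have h8 : (η - θ / 2) / (2 * η) = 1 / 2 - θ / (4 * η) := by field_simp; ring
    rw [h8] at h4 h5
    have h9 : θ / (2 * η) * ‖X n - X m‖ ^ 2 ≤ ‖Y n - Y m‖ * ‖X n - X m‖ := by
      have : θ / (2 * η) = 2 * (θ / (4 * η)) := by field_simp; norm_num
      rw [this]
      linarith
    rcases eq_or_ne (‖X n - X m‖) 0 with h0 | h0
    · rw [h0]; positivity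
    · have hp : 0 < ‖X n - X m‖ := lt_of_le_of_ne (norm_nonneg _) (Ne.symm h0)
      rw [sq, ← mul_assoc] at h9
      have h10 := le_of_mul_le_mul_right h9 hp
      calc ‖X n - X m‖ = 2 * η / θ * (θ / (2 * η) * ‖X n - X m‖) := by field_simp
        _ ≤ _ := by gcongr
  have hXc : CauchySeq X := by
    refine cauchySeq_of_le_tendsto_0' (fun n : ℕ => 2 * η / θ * (2 * (θ / 2 / 2 ^ n)))
      (fun n m hnm => ?_) ?_
    · rw [dist_eq_norm]
      refine (hXY n m).trans ?_
      gcongr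
      rw [← dist_eq_norm]
      have h1 := dist_triangle_left (Y n) (Y m) y
      have h2 : θ / 2 / 2 ^ m ≤ θ / 2 / 2 ^ n := by
        gcongr
        norm_num
      have := hY n
      have := hY m
      linarith
    · simpa using (hpow.const_mul 2).const_mul (2 * η / θ)
  obtain ⟨x, hx⟩ := cauchySeq_tendsto_of_complete hXc
  refine ⟨x, hC.mem_of_tendsto hx (Eventually.of_forall fun n => (hX n).1), ?_⟩
  exact tendsto_nhds_unique ((hYlim.sub hx).norm)
    ((((Metric.continuous_infDist_pt C).tendsto y).comp hYlim).congr fun n => ((hX n).2).symm)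

end Geometry

section Scheme

variable {H : Type*} [NormedAddCommGroup H] [InnerProductSpace ℝ H]

/-- The data of a perturbed sweeping process after a change of time: `D` is the moving set, whose
variation is controlled by `ω`, and `G σ τ x` is the integral over `[σ, τ]` of the perturbation
frozen at the point `x`. -/
structure IsSweepingData (η R : ℝ) (D : ℝ → Set H) (G : ℝ → ℝ → H → H) (ω : ℝ → ℝ) : Prop where
  isClosed : ∀ σ, IsClosed (D σ)
  nonempty : ∀ σ, (D σ).Nonempty
  prox : ∀ σ, ProxRegular η (D σ)
  abs_infDist_sub_le : ∀ σ τ, σ ≤ τ → ∀ y,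
    |Metric.infDist y (D τ) - Metric.infDist y (D σ)| ≤ ω τ - ω σ
  omega_sub_le : ∀ σ τ, σ ≤ τ → ω τ - ω σ ≤ τ - σ
  norm_le : ∀ σ τ, σ ≤ τ → ∀ ρ, ∀ x ∈ D ρ, ‖G σ τ x‖ ≤ (1 + ‖x‖) * (ω τ - ω σ)
  norm_sub_le : ∀ σ τ, σ ≤ τ → ∀ x y, ‖x‖ ≤ R → ‖y‖ ≤ R →
    ‖G σ τ x - G σ τ y‖ ≤ (τ - σ) * ‖x - y‖
  add : ∀ σ τ ρ, ∀ x, G σ τ x + G τ ρ x = G σ ρ x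

/-- A sequence produced by the catching-up algorithm with time step `h`. -/
structure IsCatchingUp (R : ℝ) (D : ℝ → Set H) (G : ℝ → ℝ → H → H) (h : ℝ) (y : ℕ → H) :
    Prop where
  mem : ∀ n : ℕ, y n ∈ D (n * h)
  norm_le : ∀ n, ‖y n‖ ≤ R
  normal : ∀ n : ℕ, y n + G (n * h) ((n + 1 : ℕ) * h) (y n) - y (n + 1) ∈
    proxNormalCone (D ((n + 1 : ℕ) * h)) (y (n + 1))
  norm_normal_le : ∀ n : ℕ, ‖y n + G (n * h) ((n + 1 : ℕ) * h) (y n) - y (n + 1)‖ ≤ (R + 2) * h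

variable {η R : ℝ} {D : ℝ → Set H} {G : ℝ → ℝ → H → H} {ω : ℝ → ℝ}

namespace IsSweepingData

theorem omega_mono (hD : IsSweepingData η R D G ω) {σ τ : ℝ} (h : σ ≤ τ) : 0 ≤ ω τ - ω σ :=
  (abs_nonneg _).trans (hD.abs_infDist_sub_le σ τ h 0)

theorem norm_le_of_mem (hD : IsSweepingData η R D G ω) {σ τ ρ : ℝ} (h : σ ≤ τ) {x : H}
    (hx : x ∈ D ρ) (hxR : ‖x‖ ≤ R) : ‖G σ τ x‖ ≤ (R + 1) * (τ - σ) := by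
  refine (hD.norm_le σ τ h ρ x hx).trans ?_
  have := hD.omega_mono h
  have := norm_nonneg x
  have := hD.omega_sub_le σ τ h
  apply mul_le_mul <;> linarith

theorem infDist_le (hD : IsSweepingData η R D G ω) {σ τ : ℝ} {y : H} (hy : y ∈ D σ) :
    Metric.infDist y (D τ) ≤ |τ - σ| := by
  have h0 := Metric.infDist_zero_of_mem hy
  rcases le_total σ τ with h | h
  · have h1 := (hD.abs_infDist_sub_le σ τ h y).trans (hD.omega_sub_le σ τ h)
    rw [h0, sub_zero] at h1
    rw [abs_of_nonneg (sub_nonneg.mpr h)]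
    exact (le_abs_self _).trans h1
  · have h1 := (hD.abs_infDist_sub_le τ σ h y).trans (hD.omega_sub_le τ σ h)
    rw [h0, zero_sub, abs_neg] at h1
    rw [abs_of_nonpos (sub_nonpos.mpr h), neg_sub]
    exact (le_abs_self _).trans h1

theorem exists_isCatchingUp [CompleteSpace H] (hη : 0 < η) (hD : IsSweepingData η R D G ω)
    {u₀ : H} (hu₀ : u₀ ∈ D 0)
    (hR : ∀ σ, 0 ≤ σ → (1 + ‖u₀‖) * Real.exp (3 * (ω σ - ω 0)) ≤ 1 + R) {h : ℝ} (hh : 0 < h)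
    (hhη : (R + 2) * h < η) : ∃ y : ℕ → H, y 0 = u₀ ∧ IsCatchingUp R D G h y := by
  have hR' : ∀ n : ℕ, ∀ x : H, 1 + ‖x‖ ≤ (1 + ‖u₀‖) * Real.exp (3 * (ω (n * h) - ω 0)) →
      ‖x‖ ≤ R := fun n x hx => by
    have := hR (n * h) (by positivity)
    linarith
  obtain ⟨y, hy0, hy⟩ := exists_seq_of_step (a := u₀)
    (Q := fun n x => x ∈ D (n * h) ∧ 1 + ‖x‖ ≤ (1 + ‖u₀‖) * Real.exp (3 * (ω (n * h) - ω 0)))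
    (R := fun n x x' => x + G (n * h) ((n + 1 : ℕ) * h) x - x' ∈
      proxNormalCone (D ((n + 1 : ℕ) * h)) x' ∧
      ‖x + G (n * h) ((n + 1 : ℕ) * h) x - x'‖ ≤ (R + 2) * h)
    ⟨by simpa using hu₀, by simp⟩ (by
      rintro n x ⟨hx, hxb⟩
      have hxR := hR' n x hxb
      have hle : (n : ℝ) * h ≤ (n + 1 : ℕ) * h := by push_cast; nlinarith
      have hsub : ((n + 1 : ℕ) : ℝ) * h - n * h = h := by push_cast; ring
      have hω := hD.omega_mono hle
      have hω1 := hD.omega_sub_le _ _ hle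
      set Δ := ω ((n + 1 : ℕ) * h) - ω (n * h) with hΔ
      have hG := hD.norm_le _ _ hle _ x hx
      rw [← hΔ] at hG
      have hdist : Metric.infDist (x + G (n * h) ((n + 1 : ℕ) * h) x) (D ((n + 1 : ℕ) * h)) ≤
          Δ + (1 + ‖x‖) * Δ := by
        have h1 := Metric.infDist_le_infDist_add_dist (s := D ((n + 1 : ℕ) * h))
          (x := x + G (n * h) ((n + 1 : ℕ) * h) x) (y := x)
        have h2 := hD.abs_infDist_sub_le _ _ hle x
        rw [Metric.infDist_zero_of_mem hx, sub_zero] at h2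
        rw [dist_eq_norm, add_sub_cancel_left] at h1
        have := (le_abs_self _).trans h2
        linarith
      have hxn := norm_nonneg x
      have hbd : Δ + (1 + ‖x‖) * Δ ≤ (R + 2) * h := by
        rw [hsub] at hω1
        have : (2 + ‖x‖) * Δ ≤ (R + 2) * h := by
          apply mul_le_mul <;> linarith
        linarith
      obtain ⟨x', hx'⟩ := (hD.prox _).exists_mem_projSet hη (hD.isClosed _) (hD.nonempty _)
        (lt_of_le_of_lt (hdist.trans hbd) hhη)
      refine ⟨x', ⟨hx'.1, ?_⟩, projSet_sub_mem_proxNormalCone hx', ?_⟩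
      · have h1 : ‖x'‖ ≤ ‖x‖ + ‖G (n * h) ((n + 1 : ℕ) * h) x‖ +
            ‖x + G (n * h) ((n + 1 : ℕ) * h) x - x'‖ := by
          calc ‖x'‖ = ‖x + G (n * h) ((n + 1 : ℕ) * h) x -
                (x + G (n * h) ((n + 1 : ℕ) * h) x - x')‖ := by congr 1; abel
            _ ≤ _ := (_root_.norm_sub_le _ _).trans (by gcongr; exact norm_add_le _ _)
        rw [hx'.2] at h1
        have h2 : 1 + ‖x'‖ ≤ (1 + ‖x‖) * (1 + 3 * Δ) := by nlinarith
        have h3 : 1 + 3 * Δ ≤ Real.exp (3 * Δ) := by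
          have := Real.add_one_le_exp (3 * Δ); linarith
        calc 1 + ‖x'‖ ≤ (1 + ‖x‖) * (1 + 3 * Δ) := h2
          _ ≤ (1 + ‖u₀‖) * Real.exp (3 * (ω (n * h) - ω 0)) * Real.exp (3 * Δ) := by gcongr
          _ = _ := by rw [mul_assoc, ← Real.exp_add, hΔ]; ring_nf
      · rw [hx'.2]
        exact hdist.trans hbd)
  exact ⟨y, hy0, fun n => (hy n).1.1, fun n => hR' n _ (hy n).1.2, fun n => (hy n).2.1,
    fun n => (hy n).2.2⟩

end IsSweepingData

namespace IsCatchingUp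

variable {h : ℝ} {y : ℕ → H}

theorem nonneg (hy : IsCatchingUp R D G h y) : 0 ≤ R :=
  (norm_nonneg _).trans (hy.norm_le 0)

theorem norm_succ_sub_le (hD : IsSweepingData η R D G ω) (hh : 0 < h)
    (hy : IsCatchingUp R D G h y) (n : ℕ) : ‖y (n + 1) - y n‖ ≤ 2 * (R + 2) * h := by
  have hle : (n : ℝ) * h ≤ (n + 1 : ℕ) * h := by push_cast; nlinarith
  have hsub : ((n + 1 : ℕ) : ℝ) * h - n * h = h := by push_cast; ring
  have h1 := hD.norm_le_of_mem hle (hy.mem n) (hy.norm_le n)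
  rw [hsub] at h1
  have h2 := hy.norm_normal_le n
  calc ‖y (n + 1) - y n‖ = ‖G (n * h) ((n + 1 : ℕ) * h) (y n) -
        (y n + G (n * h) ((n + 1 : ℕ) * h) (y n) - y (n + 1))‖ := by congr 1; abel
    _ ≤ (R + 1) * h + (R + 2) * h := (_root_.norm_sub_le _ _).trans (add_le_add h1 h2)
    _ ≤ _ := by nlinarith

theorem norm_sub_le (hD : IsSweepingData η R D G ω) (hh : 0 < h)
    (hy : IsCatchingUp R D G h y) {p q : ℕ} (hpq : p ≤ q) :
    ‖y q - y p‖ ≤ 2 * (R + 2) * (q * h - p * h) := by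
  induction q, hpq using Nat.le_induction with
  | base => simp
  | succ q hq ih =>
    calc ‖y (q + 1) - y p‖ ≤ ‖y (q + 1) - y q‖ + ‖y q - y p‖ := norm_sub_le_norm_sub_add_norm_sub ..
      _ ≤ 2 * (R + 2) * h + 2 * (R + 2) * (q * h - p * h) :=
        add_le_add (hy.norm_succ_sub_le hD hh q) ih
      _ = _ := by push_cast; ring

/-- The constant of the variational inequality satisfied by catching-up sequences. -/
def const (η R : ℝ) : ℝ :=
  (R + 2) / η + (R + 2) * η + 9 * (R + 2) ^ 3 + 3 * (R + 2) ^ 2 + (R + 2)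

theorem const_nonneg (hη : 0 < η) (hR : 0 ≤ R) : 0 ≤ const η R := by
  unfold const; positivity

theorem inner_le [CompleteSpace H] (hη : 0 < η) (hD : IsSweepingData η R D G ω) (hh : 0 < h)
    (hy : IsCatchingUp R D G h y) {p q : ℕ} (hpq : p ≤ q) (hδ : q * h - p * h ≤ η / 2) {z : H}
    (hz : z ∈ D (q * h)) :
    ⟪y p - y q + G (p * h) (q * h) (y p), z - y q⟫ ≤
      const η R * (q * h - p * h) * (‖z - y q‖ ^ 2 + (q * h - p * h)) := by
  have hR := hy.nonneg
  set K := R + 2 with hK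
  have hK1 : 1 ≤ K := by linarith
  set δ : ℝ := q * h - p * h with hδd
  have hδ0 : 0 ≤ δ := by
    rw [hδd, ← sub_mul]
    have : (p : ℝ) ≤ q := by exact_mod_cast hpq
    exact mul_nonneg (by linarith) hh.le
  set a := ‖z - y q‖ with ha
  have ha0 : 0 ≤ a := norm_nonneg _
  set B := K * ((a + 3 * K * δ) ^ 2 / (2 * η) + 3 * K * δ) + 2 * K * δ * a with hB
  have key : ∀ m, p ≤ m → m ≤ q →
      ⟪y p - y m + G (p * h) (m * h) (y p), z - y q⟫ ≤ (m * h - p * h) * B := by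
    intro m hpm
    induction m, hpm using Nat.le_induction with
    | base =>
      intro _
      have : G (p * h) (p * h) (y p) = 0 := by
        have := hD.add (p * h) (p * h) (p * h) (y p)
        simpa using this
      simp [this]
    | succ m hpm ih =>
      intro hmq
      have ih := ih (by omega)
      set v := y m + G (m * h) ((m + 1 : ℕ) * h) (y m) - y (m + 1) with hv
      have hvn : ‖v‖ ≤ K * h := hy.norm_normal_le m
      have hle : (m : ℝ) * h ≤ (m + 1 : ℕ) * h := by push_cast; nlinarith
      have hsub : ((m + 1 : ℕ) : ℝ) * h - m * h = h := by push_cast; ring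
      have hmq' : ((m + 1 : ℕ) : ℝ) * h ≤ q * h := by
        gcongr
      have hpm' : (p : ℝ) * h ≤ m * h := by
        gcongr
      -- comparison point in the intermediate set
      have hzd : Metric.infDist z (D ((m + 1 : ℕ) * h)) ≤ δ := by
        refine (hD.infDist_le hz).trans ?_
        rw [abs_sub_comm, abs_of_nonneg (by linarith)]
        linarith
      obtain ⟨z', hz', hzz'⟩ := (hD.prox _).exists_mem_projSet hη (hD.isClosed _) (hD.nonempty _)
        (lt_of_le_of_lt hzd (by linarith))
      rw [← hzz'] at hzd
      have hyq : ‖y q - y (m + 1)‖ ≤ 2 * K * δ := by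
        refine (hy.norm_sub_le hD hh hmq).trans ?_
        gcongr
        linarith
      have hym : ‖y m - y p‖ ≤ 2 * K * δ := by
        refine (hy.norm_sub_le hD hh hpm).trans ?_
        gcongr
        linarith
      have hKδ : δ ≤ K * δ := le_mul_of_one_le_left hδ0 hK1
      have h1 : ‖z' - y (m + 1)‖ ≤ a + 3 * K * δ := by
        calc ‖z' - y (m + 1)‖ = ‖(z - y q) - (z - z') + (y q - y (m + 1))‖ := by congr 1; abel
          _ ≤ a + δ + 2 * K * δ :=
            (norm_add_le _ _).trans (add_le_add ((_root_.norm_sub_le _ _).trans (by gcongr)) hyq)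
          _ ≤ _ := by linarith
      have h2 : ⟪v, z' - y (m + 1)⟫ ≤ K * h * ((a + 3 * K * δ) ^ 2 / (2 * η)) := by
        refine ((hD.prox _).inner_le hη (hy.mem (m + 1)) (hy.normal m) hz').trans ?_
        rw [div_mul_eq_mul_div, mul_div_assoc]
        gcongr
      have h3 : ⟪v, (z - z') - (y q - y (m + 1))⟫ ≤ K * h * (3 * K * δ) := by
        refine (real_inner_le_norm _ _).trans ?_
        gcongr
        refine (_root_.norm_sub_le _ _).trans ?_
        linarith only [hzd, hyq, hKδ]
      have h4 : ⟪G (m * h) ((m + 1 : ℕ) * h) (y p) - G (m * h) ((m + 1 : ℕ) * h) (y m), z - y q⟫ ≤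
          h * (2 * K * δ) * a := by
        refine (real_inner_le_norm _ _).trans ?_
        gcongr
        refine (hD.norm_sub_le _ _ hle _ _ (hy.norm_le p) (hy.norm_le m)).trans ?_
        rw [hsub, norm_sub_rev]
        gcongr
      have h5 : y p - y (m + 1) + G (p * h) ((m + 1 : ℕ) * h) (y p) =
          (y p - y m + G (p * h) (m * h) (y p)) + v +
          (G (m * h) ((m + 1 : ℕ) * h) (y p) - G (m * h) ((m + 1 : ℕ) * h) (y m)) := by
        rw [← hD.add (p * h) (m * h) ((m + 1 : ℕ) * h), hv]
        abel
      have h6 : ⟪v, z - y q⟫ = ⟪v, z' - y (m + 1)⟫ + ⟪v, (z - z') - (y q - y (m + 1))⟫ := by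
        rw [← inner_add_right]
        congr 1
        abel
      rw [h5, inner_add_left, inner_add_left, h6]
      have h7 : (((m + 1 : ℕ) : ℝ) * h - p * h) * B = (m * h - p * h) * B + h * B := by
        push_cast; ring
      rw [h7, hB]
      linarith
  refine (key q hpq le_rfl).trans ?_
  rw [mul_comm (const η R), mul_assoc]
  refine mul_le_mul_of_nonneg_left ?_ hδ0
  have h1 : (a + 3 * K * δ) ^ 2 / (2 * η) ≤ a ^ 2 / η + 9 * K ^ 2 * δ := by
    rw [div_le_iff₀ (by positivity)]
    have e1 : (a ^ 2 / η + 9 * K ^ 2 * δ) * (2 * η) = 2 * a ^ 2 + 9 * K ^ 2 * δ * (2 * η) := by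
      field_simp
    have e2 : 9 * K ^ 2 * δ * (2 * δ) ≤ 9 * K ^ 2 * δ * (2 * η) := by
      gcongr; linarith
    nlinarith [sq_nonneg (a - 3 * K * δ)]
  have h2 : 2 * K * δ * a ≤ K * η * a ^ 2 + K * δ := by
    have e1 : K * δ * (2 * a) ≤ K * δ * (a ^ 2 + 1) := by
      gcongr; nlinarith [sq_nonneg (a - 1)]
    have e2 : K * δ * a ^ 2 ≤ K * η * a ^ 2 := by gcongr; linarith
    linarith
  calc B ≤ K * (a ^ 2 / η + 9 * K ^ 2 * δ + 3 * K * δ) + (K * η * a ^ 2 + K * δ) := by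
        rw [hB]; gcongr
    _ = (K / η + K * η) * a ^ 2 + (9 * K ^ 3 + 3 * K ^ 2 + K) * δ := by ring
    _ ≤ const η R * a ^ 2 + const η R * δ := by
      have : 0 ≤ K / η + K * η := by positivity
      have : 0 ≤ 9 * K ^ 3 + 3 * K ^ 2 + K := by positivity
      have hc : const η R = (K / η + K * η) + (9 * K ^ 3 + 3 * K ^ 2 + K) := by
        unfold const; rw [← hK]; ring
      rw [hc]
      exact add_le_add (mul_le_mul_of_nonneg_right (by linarith) (sq_nonneg a))
        (mul_le_mul_of_nonneg_right (by linarith) hδ0)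
    _ = _ := by ring

end IsCatchingUp

namespace IsCatchingUp

variable {h h' : ℝ} {x y : ℕ → H}

theorem norm_sub_sq_succ_le [CompleteSpace H] (hη : 0 < η) (hD : IsSweepingData η R D G ω)
    (hh' : 0 < h') {N : ℕ} (hN : h = N * h') (hh : 0 < h) (hhη : h ≤ η / 2)
    (hhA : (4 * const η R + 1) * h ≤ 1 / 2)
    (hx : IsCatchingUp R D G h x) (hy : IsCatchingUp R D G h' y) (p : ℕ) :
    ‖x (p + 1) - y ((p + 1) * N)‖ ^ 2 + h ≤
      (1 + (8 * const η R + 4) * h) * (‖x p - y (p * N)‖ ^ 2 + h) := by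
  have hA := const_nonneg hη hx.nonneg
  set A := const η R
  have hcast : ∀ m : ℕ, ((m * N : ℕ) : ℝ) * h' = m * h := fun m => by
    rw [hN]; push_cast; ring
  have hsub : ((p + 1 : ℕ) : ℝ) * h - p * h = h := by push_cast; ring
  have i1 := hx.inner_le hη hD hh (Nat.le_succ p) (by rw [Nat.succ_eq_add_one, hsub]; exact hhη)
    (z := y ((p + 1) * N)) (by rw [Nat.succ_eq_add_one, ← hcast]; exact hy.mem _)
  have i2 := hy.inner_le hη hD hh' (Nat.mul_le_mul_right N (Nat.le_succ p))
    (by rw [Nat.succ_eq_add_one, hcast, hcast, hsub]; exact hhη)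
    (z := x (p + 1)) (by rw [Nat.succ_eq_add_one, hcast]; exact hx.mem _)
  rw [Nat.succ_eq_add_one] at i1 i2
  rw [hcast, hcast, hsub] at i2
  rw [hsub, norm_sub_rev] at i1
  have hle : (p : ℝ) * h ≤ (p + 1 : ℕ) * h := by linarith
  have hG := hD.norm_sub_le _ _ hle _ _ (hx.norm_le p) (hy.norm_le (p * N))
  rw [hsub] at hG
  set g := G (p * h) ((p + 1 : ℕ) * h) (x p)
  set g' := G (p * h) ((p + 1 : ℕ) * h) (y (p * N))
  set a := ‖x p - y (p * N)‖
  have ha : 0 ≤ a := norm_nonneg _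
  set e := x (p + 1) - y ((p + 1) * N) with he
  set b := ‖e‖
  have hb : 0 ≤ b := norm_nonneg _
  have key : b ^ 2 = ⟪x p - x (p + 1) + g, y ((p + 1) * N) - x (p + 1)⟫ +
      ⟪y (p * N) - y ((p + 1) * N) + g', e⟫ + ⟪x p - y (p * N), e⟫ + ⟪g - g', e⟫ := by
    rw [show y ((p + 1) * N) - x (p + 1) = -e by rw [he]; abel, inner_neg_right,
      ← inner_neg_left, ← inner_add_left, ← inner_add_left, ← inner_add_left,
      ← real_inner_self_eq_norm_sq]
    congr 1
    rw [he]
    abel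
  have h1 : ⟪x p - y (p * N), e⟫ ≤ a * b := real_inner_le_norm _ _
  have h2 : ⟪g - g', e⟫ ≤ h * a * b := (real_inner_le_norm _ _).trans (by gcongr)
  have h3 : (1 + h) * (2 * (a * b)) ≤ (1 + h) * (a ^ 2 + b ^ 2) := by
    gcongr; nlinarith [sq_nonneg (a - b)]
  set s := (4 * A + 1) * h with hs
  have hs0 : 0 ≤ s := by positivity
  have h4 : (1 - s) * b ^ 2 ≤ (1 + h) * a ^ 2 + 4 * A * h * h := by
    rw [hs]; linarith
  have h5 : b ^ 2 ≤ (1 + 2 * s) * ((1 - s) * b ^ 2) := by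
    have : 0 ≤ s * (1 - 2 * s) * b ^ 2 :=
      mul_nonneg (mul_nonneg hs0 (by linarith)) (sq_nonneg b)
    linarith
  have h6 : (1 + 2 * s) * ((1 - s) * b ^ 2) ≤ (1 + 2 * s) * ((1 + h) * a ^ 2 + 4 * A * h * h) := by
    gcongr
  have h7 : 2 * s * (h * a ^ 2) ≤ 1 * (h * a ^ 2) := by gcongr; linarith
  have h8 : 2 * s * (4 * A * h * h) ≤ 1 * (4 * A * h * h) := by gcongr; linarith
  have h9 : 0 ≤ h * h := by positivity
  rw [hs] at h5 h6 h7 h8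
  linarith [h5.trans h6]

theorem norm_sub_sq_le [CompleteSpace H] (hη : 0 < η) (hD : IsSweepingData η R D G ω)
    (hh' : 0 < h') {N : ℕ} (hN : h = N * h') (hh : 0 < h) (hhη : h ≤ η / 2)
    (hhA : (4 * const η R + 1) * h ≤ 1 / 2)
    (hx : IsCatchingUp R D G h x) (hy : IsCatchingUp R D G h' y) (h0 : x 0 = y 0) (p : ℕ) :
    ‖x p - y (p * N)‖ ^ 2 ≤ h * Real.exp ((8 * const η R + 4) * (p * h)) := by
  have hA := const_nonneg hη hx.nonneg
  have key : ∀ p : ℕ, ‖x p - y (p * N)‖ ^ 2 + h ≤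
      h * Real.exp ((8 * const η R + 4) * (p * h)) := by
    intro p
    induction p with
    | zero => simp [h0]
    | succ p ih =>
      calc _ ≤ (1 + (8 * const η R + 4) * h) * (‖x p - y (p * N)‖ ^ 2 + h) :=
            norm_sub_sq_succ_le hη hD hh' hN hh hhη hhA hx hy p
        _ ≤ Real.exp ((8 * const η R + 4) * h) *
            (h * Real.exp ((8 * const η R + 4) * (p * h))) := by
            gcongr
            linarith [Real.add_one_le_exp ((8 * const η R + 4) * h)]
        _ = _ := by
            rw [mul_left_comm, ← Real.exp_add]
            congr 2
            push_cast
            ring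
  linarith [key p]

end IsCatchingUp

/-- The catching-up sequences converge, as the time step tends to `0`, to a Lipschitz path in the
moving set that satisfies the variational inequality of the sweeping process on short intervals. -/
theorem IsSweepingData.exists_path [CompleteSpace H] (hη : 0 < η) (hD : IsSweepingData η R D G ω)
    {u₀ : H} (hu₀ : u₀ ∈ D 0)
    (hR : ∀ σ, 0 ≤ σ → (1 + ‖u₀‖) * Real.exp (3 * (ω σ - ω 0)) ≤ 1 + R) :
    ∃ u : ℝ → H, u 0 = u₀ ∧ (∀ σ, 0 ≤ σ → u σ ∈ D σ) ∧ (∀ σ, 0 ≤ σ → ‖u σ‖ ≤ R) ∧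
      (∀ σ τ, 0 ≤ σ → σ ≤ τ → ‖u τ - u σ‖ ≤ 2 * (R + 2) * (τ - σ)) ∧
      ∀ σ τ, 0 ≤ σ → σ ≤ τ → τ - σ ≤ η / 4 → ∀ z ∈ D τ,
        ⟪u σ - u τ + G σ τ (u σ), z - u τ⟫ ≤
          IsCatchingUp.const η R * (τ - σ) * (‖z - u τ‖ ^ 2 + (τ - σ)) := by
  have hR0 : 0 ≤ R := by
    have := hR 0 le_rfl
    simp only [sub_self, mul_zero, Real.exp_zero, mul_one] at this
    linarith [norm_nonneg u₀]
  have hA := IsCatchingUp.const_nonneg hη hR0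
  set A := IsCatchingUp.const η R
  obtain ⟨h₀, hh₀, hh₀R, hh₀η, hh₀A⟩ : ∃ h₀ : ℝ, 0 < h₀ ∧ (R + 2) * h₀ < η ∧ h₀ ≤ η / 4 ∧
      (4 * A + 1) * h₀ ≤ 1 / 2 := by
    refine ⟨min (η / (4 * (R + 2))) (1 / (2 * (4 * A + 1))), by positivity, ?_, ?_, ?_⟩
    · calc _ ≤ (R + 2) * (η / (4 * (R + 2))) := by gcongr; exact min_le_left _ _
        _ = η / 4 := by field_simp
        _ < η := by linarith
    · refine (min_le_left _ _).trans ?_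
      gcongr
      linarith
    · calc _ ≤ (4 * A + 1) * (1 / (2 * (4 * A + 1))) := by gcongr; exact min_le_right _ _
        _ = 1 / 2 := by field_simp
  set h : ℕ → ℝ := fun n => h₀ / 2 ^ n with hhd
  have hh : ∀ n, 0 < h n := fun n => by positivity
  have hhle : ∀ n, h n ≤ h₀ := fun n => div_le_self hh₀.le (one_le_pow₀ one_le_two)
  have hh0 : Tendsto h atTop (𝓝 0) := by
    have := (tendsto_pow_atTop_nhds_zero_of_lt_one (r := (1 / 2 : ℝ)) (by norm_num)
      (by norm_num)).const_mul h₀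
    rw [mul_zero] at this
    refine this.congr fun n => ?_
    simp only [hhd]
    rw [one_div, inv_pow, div_eq_mul_inv]
  have hex : ∀ n, ∃ y : ℕ → H, y 0 = u₀ ∧ IsCatchingUp R D G (h n) y := fun n =>
    hD.exists_isCatchingUp hη hu₀ hR (hh n)
      (lt_of_le_of_lt (mul_le_mul_of_nonneg_left (hhle n) (by linarith)) hh₀R)
  choose y hy0 hy using hex
  set N : ℝ → ℕ → ℕ := fun σ n => ⌊σ / h n⌋₊ with hN
  set s : ℝ → ℕ → ℝ := fun σ n => N σ n * h n with hs
  have hs1 : ∀ σ n, 0 ≤ σ → s σ n ≤ σ := fun σ n hσ =>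
    (le_div_iff₀ (hh n)).mp (Nat.floor_le (div_nonneg hσ (hh n).le))
  have hs2 : ∀ σ n, σ - s σ n ≤ h n := fun σ n => by
    have := (div_lt_iff₀ (hh n)).mp (Nat.lt_floor_add_one (σ / h n))
    simp only [hs, hN]
    linarith
  have hNmono : ∀ σ τ n, σ ≤ τ → N σ n ≤ N τ n := fun σ τ n hστ =>
    Nat.floor_le_floor (div_le_div_of_nonneg_right hστ (hh n).le)
  have hslim : ∀ σ, 0 ≤ σ → Tendsto (s σ) atTop (𝓝 σ) := fun σ hσ => by
    have h1 : Tendsto (fun n => σ - h n) atTop (𝓝 σ) := by simpa using hh0.const_sub σ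
    exact tendsto_of_tendsto_of_tendsto_of_le_of_le h1 tendsto_const_nhds
      (fun n => by have := hs2 σ n; simp only; linarith) (fun n => hs1 σ n hσ)
  set v : ℝ → ℕ → H := fun σ n => y n (N σ n) with hv
  have hlim : ∀ σ, ∃ l, 0 ≤ σ → Tendsto (v σ) atTop (𝓝 l) := by
    intro σ
    by_cases hσ : 0 ≤ σ
    swap
    · exact ⟨0, fun h => absurd h hσ⟩
    set b : ℕ → ℝ := fun n =>
      √(h n * Real.exp ((8 * A + 4) * σ)) + 2 * (R + 2) * h n with hb
    have hb0 : Tendsto b atTop (𝓝 0) := by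
      have h1 := ((hh0.mul_const (Real.exp ((8 * A + 4) * σ))).sqrt).add
        (hh0.const_mul (2 * (R + 2)))
      simpa using h1
    have hc : CauchySeq (v σ) := by
      refine cauchySeq_of_le_tendsto_0' b (fun n m hnm => ?_) hb0
      have hNN : h n = (2 ^ (m - n) : ℕ) * h m := by
        simp only [hhd]
        push_cast
        rw [mul_div_assoc', eq_div_iff (by positivity), div_mul_eq_mul_div,
          div_eq_iff (by positivity), mul_right_comm, ← pow_add, Nat.sub_add_cancel hnm, mul_comm]
      have hle : N σ n * 2 ^ (m - n) ≤ N σ m := by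
        refine Nat.le_floor ?_
        rw [le_div_iff₀ (hh m)]
        push_cast at hNN ⊢
        rw [mul_assoc, ← hNN]
        exact hs1 σ n hσ
      have h1 := (hy n).norm_sub_sq_le hη hD (hh m) hNN (hh n)
        (by linarith [hhle n]) (le_trans (by gcongr; exact hhle n) hh₀A) (hy m)
        ((hy0 n).trans (hy0 m).symm) (N σ n)
      have h2 := (hy m).norm_sub_le hD (hh m) hle
      have h3 : ((N σ n * 2 ^ (m - n) : ℕ) : ℝ) * h m = s σ n := by
        push_cast at hNN ⊢
        rw [mul_assoc, ← hNN]
      rw [h3] at h2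
      rw [dist_eq_norm]
      calc ‖v σ n - v σ m‖ = ‖(y n (N σ n) - y m (N σ n * 2 ^ (m - n))) -
              (y m (N σ m) - y m (N σ n * 2 ^ (m - n)))‖ := by
            congr 1; simp only [hv]; abel
        _ ≤ _ := _root_.norm_sub_le _ _
        _ ≤ b n := by
            refine add_le_add (Real.le_sqrt_of_sq_le (h1.trans ?_)) (h2.trans ?_)
            · have := hs1 σ n hσ
              have := (hh n).le
              gcongr
            · have := hs1 σ m hσ
              have h5 := hs2 σ n
              simp only [hs] at this h5 ⊢
              gcongr
              linarith
    obtain ⟨l, hl⟩ := cauchySeq_tendsto_of_complete hc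
    exact ⟨l, fun _ => hl⟩
  choose u hu using hlim
  have huR : ∀ σ, 0 ≤ σ → ‖u σ‖ ≤ R := fun σ hσ =>
    le_of_tendsto (hu σ hσ).norm (Eventually.of_forall fun n => (hy n).norm_le _)
  have huD : ∀ σ, 0 ≤ σ → u σ ∈ D σ := by
    intro σ hσ
    rw [(hD.isClosed σ).mem_iff_infDist_zero (hD.nonempty σ)]
    have h1 : Tendsto (fun n => Metric.infDist (v σ n) (D σ)) atTop
        (𝓝 (Metric.infDist (u σ) (D σ))) :=
      ((Metric.continuous_infDist_pt (D σ)).tendsto (u σ)).comp (hu σ hσ)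
    refine tendsto_nhds_unique h1 (squeeze_zero (fun _ => Metric.infDist_nonneg) (fun n => ?_) hh0)
    refine (hD.infDist_le ((hy n).mem (N σ n))).trans ?_
    have h3 := hs1 σ n hσ
    have h4 := hs2 σ n
    simp only [hs] at h3 h4
    rw [abs_of_nonneg (by linarith)]
    exact h4
  refine ⟨u, ?_, huD, huR, ?_, ?_⟩
  · refine tendsto_nhds_unique (hu 0 le_rfl) (tendsto_const_nhds.congr fun n => ?_)
    simp [hv, hN, hy0]
  · intro σ τ hσ hστ
    have hτ := hσ.trans hστ
    refine le_of_tendsto_of_tendsto ((hu τ hτ).sub (hu σ hσ)).norm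
      (((hslim τ hτ).sub (hslim σ hσ)).const_mul _) (Eventually.of_forall fun n => ?_)
    exact (hy n).norm_sub_le hD (hh n) (hNmono σ τ n hστ)
  · intro σ τ hσ hστ hη4 z hz
    have hτ := hσ.trans hστ
    have hzex : ∀ n, ∃ z' ∈ D (s τ n), dist z z' < 2 * h n := fun n => by
      refine (Metric.infDist_lt_iff (hD.nonempty _)).mp
        ((hD.infDist_le hz).trans_lt ?_)
      rw [abs_sub_comm, abs_of_nonneg (sub_nonneg.mpr (hs1 τ n hτ))]
      linarith [hs2 τ n, hh n]
    choose z' hz'D hz'z using hzex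
    have hz'lim : Tendsto z' atTop (𝓝 z) := by
      rw [tendsto_iff_dist_tendsto_zero]
      refine squeeze_zero (fun _ => dist_nonneg) (fun n => ?_)
        (by simpa using hh0.const_mul 2)
      rw [dist_comm]
      exact (hz'z n).le
    have hsmono : ∀ n, s σ n ≤ s τ n := fun n =>
      mul_le_mul_of_nonneg_right (Nat.cast_le.mpr (hNmono σ τ n hστ)) (hh n).le
    have hGlim : Tendsto (fun n => G (s σ n) (s τ n) (v σ n)) atTop (𝓝 (G σ τ (u σ))) := by
      rw [tendsto_iff_norm_sub_tendsto_zero]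
      have hbd : Tendsto (fun n => (s τ n - s σ n) * ‖v σ n - u σ‖ +
          ((R + 1) * (σ - s σ n) + (R + 1) * (τ - s τ n))) atTop (𝓝 0) := by
        have h1 := ((hslim τ hτ).sub (hslim σ hσ)).mul ((hu σ hσ).sub_const (u σ)).norm
        have h2 := ((hslim σ hσ).const_sub σ).const_mul (R + 1)
        have h3 := ((hslim τ hτ).const_sub τ).const_mul (R + 1)
        simpa using h1.add (h2.add h3)
      refine squeeze_zero (fun _ => norm_nonneg _) (fun n => ?_) hbd
      have e1 := hD.add (s σ n) (s τ n) τ (u σ)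
      have e2 := hD.add (s σ n) σ τ (u σ)
      have e3 : G (s σ n) (s τ n) (v σ n) - G σ τ (u σ) =
          (G (s σ n) (s τ n) (v σ n) - G (s σ n) (s τ n) (u σ)) +
          (G (s σ n) σ (u σ) - G (s τ n) τ (u σ)) := by
        rw [← e2] at e1
        rw [eq_sub_of_add_eq e1]
        abel
      rw [e3]
      refine (norm_add_le _ _).trans (add_le_add ?_
        ((_root_.norm_sub_le _ _).trans (add_le_add ?_ ?_)))
      · exact hD.norm_sub_le _ _ (hsmono n) _ _ ((hy n).norm_le _) (huR σ hσ)
      · exact hD.norm_le_of_mem (hs1 σ n hσ) (huD σ hσ) (huR σ hσ)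
      · exact hD.norm_le_of_mem (hs1 τ n hτ) (huD σ hσ) (huR σ hσ)
    have hδ := (hslim τ hτ).sub (hslim σ hσ)
    refine le_of_tendsto_of_tendsto
      ((((hu σ hσ).sub (hu τ hτ)).add hGlim).inner (hz'lim.sub (hu τ hτ)))
      ((hδ.const_mul A).mul (((hz'lim.sub (hu τ hτ)).norm.pow 2).add hδ))
      (Eventually.of_forall fun n => ?_)
    exact (hy n).inner_le hη hD (hh n) (hNmono σ τ n hστ)
      (by
        have h3 := hs1 τ n hτ
        have h4 := hs2 σ n
        have h5 := hhle n
        simp only [hs] at h3 h4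
        linarith) (hz'D n)

end Scheme

section RadonNikodym

variable {E : Type*} [NormedAddCommGroup E] [InnerProductSpace ℝ E] [CompleteSpace E]

/-- A bounded sequence of a Hilbert space converges weakly along the hyperfilter. -/
theorem exists_tendsto_inner_hyperfilter {f : ℕ → E} {r : ℝ} (hf : ∀ n, ‖f n‖ ≤ r) :
    ∃ g : E, ∀ e, Tendsto (fun n => ⟪f n, e⟫) (hyperfilter ℕ : Filter ℕ) (𝓝 ⟪g, e⟫) := by
  have hK := WeakDual.isCompact_closedBall (𝕜 := ℝ) (E := E) (0 : StrongDual ℝ E) r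
  obtain ⟨φ, -, hφ⟩ := hK.ultrafilter_le_nhds'
    ((hyperfilter ℕ).map fun n => StrongDual.toWeakDual (InnerProductSpace.toDual ℝ E (f n)))
    (Ultrafilter.mem_map.mpr <| univ_mem' fun n => mem_closedBall_zero_iff.mpr <|
      ((InnerProductSpace.toDual ℝ E).norm_map (f n)).trans_le (hf n))
  refine ⟨(InnerProductSpace.toDual ℝ E).symm (WeakDual.toStrongDual φ), fun e => ?_⟩
  rw [InnerProductSpace.toDual_symm_apply]
  exact tendsto_iff_forall_eval_tendsto_topDualPairing.mp hφ e

theorem tendsto_smul_integral_of_lipschitzWith {K : NNReal} {u : ℝ → E} (hu : LipschitzWith K u)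
    (t : ℝ) : Tendsto (fun n : ℕ => ((n : ℝ) + 1) • ∫ s in t..t + 1 / ((n : ℝ) + 1), u s) atTop
      (𝓝 (u t)) := by
  rw [tendsto_iff_norm_sub_tendsto_zero]
  refine squeeze_zero (fun _ => norm_nonneg _) (fun n => ?_)
    (by simpa only [mul_zero] using
      (tendsto_one_div_add_atTop_nhds_zero_nat (𝕜 := ℝ)).const_mul (K : ℝ))
  have hn : (0 : ℝ) < (n : ℝ) + 1 := by positivity
  set a := 1 / ((n : ℝ) + 1) with ha
  have ha0 : 0 < a := by positivity
  have hna : ((n : ℝ) + 1) * a = 1 := by rw [ha]; field_simp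
  have h1 : ((n : ℝ) + 1) • (∫ s in t..t + a, u s) - u t =
      ((n : ℝ) + 1) • ∫ s in t..t + a, (u s - u t) := by
    rw [intervalIntegral.integral_sub (hu.continuous.intervalIntegrable _ _) (by simp),
      intervalIntegral.integral_const, smul_sub, smul_smul, add_sub_cancel_left, hna, one_smul]
  have h2 : ‖∫ s in t..t + a, (u s - u t)‖ ≤ K * a * |t + a - t| := by
    refine intervalIntegral.norm_integral_le_of_norm_le_const fun s hs => ?_
    rw [uIoc_of_le (by linarith)] at hs
    rw [← dist_eq_norm]
    refine (hu.dist_le_mul s t).trans ?_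
    gcongr
    rw [Real.dist_eq, abs_of_nonneg (by linarith [hs.1])]
    linarith [hs.2]
  rw [h1, norm_smul, Real.norm_of_nonneg hn.le]
  rw [add_sub_cancel_left, abs_of_nonneg ha0.le] at h2
  calc _ ≤ ((n : ℝ) + 1) * (K * a * a) := by gcongr
    _ = K * a * (((n : ℝ) + 1) * a) := by ring
    _ = K * a := by rw [hna, mul_one]

/-- A Lipschitz path in a Hilbert space is, on bounded intervals, the indefinite integral of an
integrable function. -/
theorem exists_integrable_density_of_lipschitzWith {K : NNReal} {u : ℝ → E}
    (hu : LipschitzWith K u) (L : ℝ) :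
    ∃ g : ℝ → E, Integrable g ∧
      ∀ t ∈ Icc 0 L, u t = u 0 + ∫ s in (0 : ℝ)..t, g s := by
  set μ := (volume : Measure ℝ).restrict (Ioc 0 L) with hμ
  have hpos : ∀ n : ℕ, (0 : ℝ) < (n : ℝ) + 1 := fun n => by positivity
  set q : ℕ → ℝ → E := fun n s => ((n : ℝ) + 1) • (u (s + 1 / ((n : ℝ) + 1)) - u s) with hq
  have hqc : ∀ n, Continuous (q n) := fun n => by
    have := hu.continuous
    fun_prop
  have hqb : ∀ n s, ‖q n s‖ ≤ K := fun n s => by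
    have hn := hpos n
    rw [hq]
    simp only
    rw [norm_smul, Real.norm_of_nonneg hn.le, ← dist_eq_norm]
    calc _ ≤ ((n : ℝ) + 1) * (K * dist (s + 1 / ((n : ℝ) + 1)) s) := by
          gcongr; exact hu.dist_le_mul _ _
      _ = K := by
          rw [Real.dist_eq, add_sub_cancel_left, abs_of_pos (by positivity)]
          field_simp
  have hmem : ∀ n, MemLp (q n) 2 μ := fun n =>
    MemLp.of_bound (hqc n).aestronglyMeasurable K (Eventually.of_forall (hqb n))
  set F : ℕ → Lp E 2 μ := fun n => (hmem n).toLp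
  have hFb : ∀ n, ‖F n‖ ≤ measureUnivNNReal μ ^ (2 : ENNReal).toReal⁻¹ * (K : ℝ) := fun n =>
    Lp.norm_le_of_ae_bound K.2 ((hmem n).coeFn_toLp.mono fun s hs => by rw [hs]; exact hqb n s)
  obtain ⟨g, hg⟩ := exists_tendsto_inner_hyperfilter hFb
  have hgint : Integrable (fun s => g s) μ := (Lp.memLp g).integrable (by norm_num)
  refine ⟨(Ioc 0 L).indicator g, (integrable_indicator_iff measurableSet_Ioc).mpr hgint,
    fun t ht => ?_⟩
  have hsub : Ioc 0 t ⊆ Ioc 0 L := Ioc_subset_Ioc_right ht.2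
  have hrestr : μ.restrict (Ioc 0 t) = volume.restrict (Ioc 0 t) := by
    rw [hμ, Measure.restrict_restrict measurableSet_Ioc, inter_eq_left.mpr hsub]
  have hgi : ∫ s in (0 : ℝ)..t, (Ioc 0 L).indicator g s = ∫ s in Ioc 0 t, g s ∂μ := by
    rw [intervalIntegral.integral_of_le ht.1, hrestr]
    exact setIntegral_congr_fun measurableSet_Ioc fun s hs => indicator_of_mem (hsub hs) _
  have hlim : Tendsto (fun n => ∫ s in (0 : ℝ)..t, q n s) atTop (𝓝 (u t - u 0)) := by
    refine ((tendsto_smul_integral_of_lipschitzWith hu t).sub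
      (tendsto_smul_integral_of_lipschitzWith hu 0)).congr fun n => ?_
    have hi : ∀ a b : ℝ, IntervalIntegrable u volume a b := hu.continuous.intervalIntegrable
    rw [hq]
    simp only
    rw [intervalIntegral.integral_smul, intervalIntegral.integral_sub
      (Continuous.intervalIntegrable (by have := hu.continuous; fun_prop) _ _) (hi _ _),
      intervalIntegral.integral_comp_add_right, ← smul_sub,
      intervalIntegral.integral_interval_sub_interval_comm' (hi _ _) (hi _ _) (hi _ _)]
  rw [hgi, ← sub_eq_iff_eq_add']
  refine ext_inner_left ℝ fun c => ?_
  have hfin : μ (Ioc 0 t) ≠ ⊤ := measure_ne_top _ _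
  have h1 := hg (indicatorConstLp 2 measurableSet_Ioc hfin c)
  simp only [real_inner_comm (indicatorConstLp 2 measurableSet_Ioc hfin c),
    L2.inner_indicatorConstLp_eq_inner_setIntegral] at h1
  refine tendsto_nhds_unique ?_ h1
  refine ((tendsto_const_nhds (x := c)).inner
    (hlim.mono_left Nat.hyperfilter_le_atTop)).congr fun n => ?_
  congr 1
  rw [intervalIntegral.integral_of_le ht.1, ← hrestr]
  exact integral_congr_ae (ae_restrict_of_ae ((hmem n).coeFn_toLp.mono fun s hs => hs.symm))

end RadonNikodym

section TimeChange

/-- The increasing change of time `t ↦ ∫₀ᵗ (1 + φ)`. -/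
def timeChange (φ : ℝ → ℝ) (t : ℝ) : ℝ := t + ∫ s in (0 : ℝ)..t, φ s

variable {φ : ℝ → ℝ}

theorem timeChange_zero : timeChange φ 0 = 0 := by simp [timeChange]

theorem timeChange_sub (hφ : Integrable φ) (s t : ℝ) :
    timeChange φ t - timeChange φ s = (t - s) + ∫ r in s..t, φ r := by
  have := intervalIntegral.integral_interval_sub_left (a := 0) (b := t) (c := s)
    hφ.intervalIntegrable hφ.intervalIntegrable
  simp only [timeChange]
  linarith

theorem sub_le_timeChange_sub (hφ : Integrable φ) (hφ0 : 0 ≤ φ) {s t : ℝ} (h : s ≤ t) :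
    t - s ≤ timeChange φ t - timeChange φ s := by
  rw [timeChange_sub hφ]
  linarith [intervalIntegral.integral_nonneg (μ := volume) h fun r _ => hφ0 r]

theorem continuous_timeChange (hφ : Integrable φ) : Continuous (timeChange φ) :=
  continuous_id.add (intervalIntegral.continuous_primitive (fun _ _ => hφ.intervalIntegrable) 0)

theorem strictMono_timeChange (hφ : Integrable φ) (hφ0 : 0 ≤ φ) : StrictMono (timeChange φ) :=
  fun s t h => by linarith [sub_le_timeChange_sub hφ hφ0 h.le]

theorem surjective_timeChange (hφ : Integrable φ) (hφ0 : 0 ≤ φ) :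
    Function.Surjective (timeChange φ) := by
  have h0 := timeChange_zero (φ := φ)
  refine (continuous_timeChange hφ).surjective ?_ ?_
  · refine tendsto_atTop_mono' _ ?_ tendsto_id
    filter_upwards [eventually_ge_atTop 0] with t ht
    have := sub_le_timeChange_sub hφ hφ0 ht
    simp only [id]
    linarith
  · refine tendsto_atBot_mono' _ ?_ tendsto_id
    filter_upwards [eventually_le_atBot 0] with t ht
    have := sub_le_timeChange_sub hφ hφ0 ht
    simp only [id]
    linarith

/-- `timeChange φ` as an order isomorphism. -/
def timeChangeIso (hφ : Integrable φ) (hφ0 : 0 ≤ φ) : ℝ ≃o ℝ :=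
  (strictMono_timeChange hφ hφ0).orderIsoOfSurjective _ (surjective_timeChange hφ hφ0)

theorem map_timeChange_withDensity (hφ : Integrable φ) (hφ0 : 0 ≤ φ) :
    (volume.withDensity fun t => ((1 + φ t).toNNReal : ENNReal)).map (timeChange φ) = volume := by
  set e := timeChangeIso hφ hφ0 with he
  have hev : ∀ t, timeChange φ t = e t := fun t => rfl
  refine (Measure.ext_of_Ioc _ _ fun a b hab => ?_).symm
  rw [Measure.map_apply (continuous_timeChange hφ).measurable measurableSet_Ioc]
  have hpre : timeChange φ ⁻¹' Ioc a b = Ioc (e.symm a) (e.symm b) := by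
    rw [← OrderIso.preimage_Ioc]
    rfl
  have hle : e.symm a ≤ e.symm b := e.symm.monotone hab.le
  have hi : IntervalIntegrable (fun t => 1 + φ t) volume (e.symm a) (e.symm b) :=
    intervalIntegrable_const.add hφ.intervalIntegrable
  have hint : ∫ t in Ioc (e.symm a) (e.symm b), (1 + φ t) = b - a := by
    rw [← intervalIntegral.integral_of_le hle, intervalIntegral.integral_add
      intervalIntegrable_const hφ.intervalIntegrable, intervalIntegral.integral_const,
      smul_eq_mul, mul_one, ← timeChange_sub hφ, hev, hev, e.apply_symm_apply, e.apply_symm_apply]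
  rw [hpre, withDensity_apply _ measurableSet_Ioc, Real.volume_Ioc, ← hint]
  exact ofReal_integral_eq_lintegral_ofReal ((intervalIntegrable_iff_integrableOn_Ioc_of_le hle).mp
    hi) (Eventually.of_forall fun t => add_nonneg zero_le_one (hφ0 t))

variable {E : Type*} [NormedAddCommGroup E] [NormedSpace ℝ E]

theorem integrable_smul_comp_timeChange (hφ : Integrable φ) (hφ0 : 0 ≤ φ)
    {g : ℝ → E} (hg : Integrable g) : Integrable fun t => (1 + φ t) • g (timeChange φ t) := by
  have hemb : MeasurableEmbedding (timeChange φ) :=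
    (timeChangeIso hφ hφ0).toHomeomorph.measurableEmbedding
  rw [← map_timeChange_withDensity hφ hφ0, hemb.integrable_map_iff,
    integrable_withDensity_iff_integrable_smul₀
      (hφ.aemeasurable.const_add 1).real_toNNReal] at hg
  refine hg.congr (Eventually.of_forall fun t => ?_)
  simp only [NNReal.smul_def, Function.comp_apply]
  rw [Real.coe_toNNReal _ (add_nonneg zero_le_one (hφ0 t))]

theorem integral_smul_comp_timeChange (hφ : Integrable φ) (hφ0 : 0 ≤ φ)
    (g : ℝ → E) {a b : ℝ} (hab : a ≤ b) :
    ∫ t in a..b, (1 + φ t) • g (timeChange φ t) =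
      ∫ s in timeChange φ a..timeChange φ b, g s := by
  have hemb : MeasurableEmbedding (timeChange φ) :=
    (timeChangeIso hφ hφ0).toHomeomorph.measurableEmbedding
  have hpre : timeChange φ ⁻¹' Ioc (timeChange φ a) (timeChange φ b) = Ioc a b := by
    ext t
    simp [(strictMono_timeChange hφ hφ0).lt_iff_lt, (strictMono_timeChange hφ hφ0).le_iff_le]
  rw [intervalIntegral.integral_of_le hab,
    intervalIntegral.integral_of_le ((strictMono_timeChange hφ hφ0).monotone hab)]
  nth_rw 2 [← map_timeChange_withDensity hφ hφ0]
  rw [hemb.setIntegral_map, hpre,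
    setIntegral_withDensity_eq_setIntegral_smul₀
      (hφ.aemeasurable.const_add 1).real_toNNReal.restrict _ measurableSet_Ioc]
  refine setIntegral_congr_fun measurableSet_Ioc fun t _ => ?_
  simp only [NNReal.smul_def]
  rw [Real.coe_toNNReal _ (add_nonneg zero_le_one (hφ0 t))]

end TimeChange

section Path

variable {H : Type*} [NormedAddCommGroup H] [InnerProductSpace ℝ H]

/-- The data of a perturbed sweeping process on the whole line, whose moving set has variation
controlled by the density `a`, and whose perturbation `f` grows with rate `a` on the moving set and
is Lipschitz with rate `φ` on the ball of radius `R`. -/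
structure IsPerturbedData (η R : ℝ) (C : ℝ → Set H) (f : ℝ → H → H) (a φ : ℝ → ℝ) : Prop where
  isClosed : ∀ t, IsClosed (C t)
  nonempty : ∀ t, (C t).Nonempty
  prox : ∀ t, ProxRegular η (C t)
  nonneg : 0 ≤ a
  le : a ≤ φ
  integrable_a : Integrable a
  integrable : Integrable φ
  abs_infDist_sub_le : ∀ s t, s ≤ t → ∀ y,
    |Metric.infDist y (C t) - Metric.infDist y (C s)| ≤ ∫ r in s..t, a r
  stronglyMeasurable : ∀ x, StronglyMeasurable fun t => f t x
  continuous : ∀ t, Continuous (f t)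
  norm_le : ∀ t s, ∀ x ∈ C s, ‖f t x‖ ≤ a t * (1 + ‖x‖)
  norm_sub_le : ∀ t x y, ‖x‖ ≤ R → ‖y‖ ≤ R → ‖f t x - f t y‖ ≤ φ t * ‖x - y‖

namespace IsPerturbedData

variable {η R : ℝ} {C : ℝ → Set H} {f : ℝ → H → H} {a φ : ℝ → ℝ}

theorem phi_nonneg (hC : IsPerturbedData η R C f a φ) : 0 ≤ φ := hC.nonneg.trans hC.le

theorem integrable_apply (hC : IsPerturbedData η R C f a φ) {s : ℝ} {x y : H} (hx : x ∈ C s)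
    (hxR : ‖x‖ ≤ R) (hyR : ‖y‖ ≤ R) : Integrable fun t => f t y := by
  refine ((hC.integrable_a.mul_const (1 + ‖x‖)).add (hC.integrable.mul_const ‖y - x‖)).mono'
    (hC.stronglyMeasurable y).aestronglyMeasurable (Eventually.of_forall fun t => ?_)
  calc ‖f t y‖ = ‖f t x + (f t y - f t x)‖ := by congr 1; abel
    _ ≤ _ := (norm_add_le _ _).trans
      (add_le_add (hC.norm_le t s x hx) (hC.norm_sub_le t y x hyR hxR))

theorem norm_integral_sub_le (hC : IsPerturbedData η R C f a φ) {s t : ℝ} (hst : s ≤ t)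
    {F F' : ℝ → H} (hF : Integrable F) (hF' : Integrable F') {c : ℝ}
    (h : ∀ r ∈ Ioc s t, ‖F r - F' r‖ ≤ φ r * c) (hc : 0 ≤ c) :
    ‖(∫ r in s..t, F r) - ∫ r in s..t, F' r‖ ≤ (timeChange φ t - timeChange φ s) * c := by
  rw [← intervalIntegral.integral_sub hF.intervalIntegrable hF'.intervalIntegrable]
  refine (intervalIntegral.norm_integral_le_of_norm_le hst (Eventually.of_forall h)
    (hC.integrable.mul_const c).intervalIntegrable).trans ?_
  rw [intervalIntegral.integral_mul_const, timeChange_sub hC.integrable]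
  gcongr
  linarith

open scoped Classical in
theorem isSweepingData (hC : IsPerturbedData η R C f a φ) {u₀ : H} (hu₀ : u₀ ∈ C 0)
    (hu₀R : ‖u₀‖ ≤ R) {γ : ℝ → ℝ} (hγ : Monotone γ) (hWγ : ∀ σ, timeChange φ (γ σ) = σ) :
    IsSweepingData η R (fun σ => C (γ σ))
      (fun σ τ x => if ‖x‖ ≤ R then ∫ r in γ σ..γ τ, f r x else 0)
      (fun σ => ∫ r in (0 : ℝ)..γ σ, a r) := by
  have hsub : ∀ σ τ, (∫ r in (0 : ℝ)..γ τ, a r) - ∫ r in (0 : ℝ)..γ σ, a r =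
      ∫ r in γ σ..γ τ, a r := fun σ τ =>
    intervalIntegral.integral_interval_sub_left hC.integrable_a.intervalIntegrable
      hC.integrable_a.intervalIntegrable
  refine ⟨fun σ => hC.isClosed _, fun σ => hC.nonempty _, fun σ => hC.prox _, ?_, ?_, ?_, ?_, ?_⟩
  · intro σ τ hστ y
    rw [hsub]
    exact hC.abs_infDist_sub_le _ _ (hγ hστ) y
  · intro σ τ hστ
    have h1 := hγ hστ
    rw [hsub]
    calc _ ≤ ∫ r in γ σ..γ τ, φ r := intervalIntegral.integral_mono_on h1
          hC.integrable_a.intervalIntegrable hC.integrable.intervalIntegrable fun r _ => hC.le r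
      _ ≤ timeChange φ (γ τ) - timeChange φ (γ σ) := by
          rw [timeChange_sub hC.integrable]; linarith
      _ = τ - σ := by rw [hWγ, hWγ]
  · intro σ τ hστ ρ x hx
    have h1 := hγ hστ
    rw [hsub]
    split_ifs
    · refine (intervalIntegral.norm_integral_le_of_norm_le h1
        (Eventually.of_forall fun r _ => hC.norm_le r _ x hx)
        (hC.integrable_a.mul_const _).intervalIntegrable).trans_eq ?_
      rw [intervalIntegral.integral_mul_const, mul_comm]
    · rw [norm_zero]
      exact mul_nonneg (by positivity)
        (intervalIntegral.integral_nonneg h1 fun r _ => hC.nonneg r)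
  · intro σ τ hστ x y hx hy
    simp only [hx, hy, if_true]
    refine (hC.norm_integral_sub_le (hγ hστ) (hC.integrable_apply hu₀ hu₀R hx)
      (hC.integrable_apply hu₀ hu₀R hy) (fun r _ => hC.norm_sub_le r x y hx hy)
      (norm_nonneg _)).trans_eq ?_
    rw [hWγ, hWγ]
  · intro σ τ ρ x
    split_ifs with hx
    · have hi := hC.integrable_apply hu₀ hu₀R hx
      exact intervalIntegral.integral_add_adjacent_intervals hi.intervalIntegrable
        hi.intervalIntegrable
    · simp

/-- The limit of the catching-up algorithm, in the original time. -/
theorem exists_path [CompleteSpace H] (hη : 0 < η) (hC : IsPerturbedData η R C f a φ) {u₀ : H}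
    (hu₀ : u₀ ∈ C 0) (hR : (1 + ‖u₀‖) * Real.exp (3 * ∫ r, a r) ≤ 1 + R) (T : ℝ) :
    ∃ u g : ℝ → H, Integrable g ∧ (∀ t ∈ Icc 0 T, u t = u₀ + ∫ s in (0 : ℝ)..t, g s) ∧
      (∀ t, 0 ≤ t → u t ∈ C t) ∧ (∀ t, ‖u t‖ ≤ R) ∧ Continuous u ∧
      (∀ s t, s ≤ t → ‖u t - u s‖ ≤ 2 * (R + 2) * (timeChange φ t - timeChange φ s)) ∧
      ∀ s t, 0 ≤ s → s ≤ t → timeChange φ t - timeChange φ s ≤ η / 4 → ∀ z ∈ C t,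
        ⟪u s - u t + ∫ r in s..t, f r (u s), z - u t⟫ ≤
          IsCatchingUp.const η R * (timeChange φ t - timeChange φ s) *
            (‖z - u t‖ ^ 2 + (timeChange φ t - timeChange φ s)) := by
  have hint0 : 0 ≤ ∫ r, a r := integral_nonneg hC.nonneg
  have hu₀R : ‖u₀‖ ≤ R := by
    have : (1 + ‖u₀‖) * 1 ≤ (1 + ‖u₀‖) * Real.exp (3 * ∫ r, a r) := by
      gcongr
      exact Real.one_le_exp (by positivity)
    linarith
  set e := timeChangeIso hC.integrable hC.phi_nonneg
  set W := timeChange φ with hW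
  have he : ∀ t, e.symm (W t) = t := e.symm_apply_apply
  have hW0 : W 0 = 0 := timeChange_zero
  have he0 : e.symm 0 = 0 := by
    have := he 0
    rwa [hW0] at this
  have hWmono : Monotone W := e.monotone
  have hWpos : ∀ t, 0 ≤ t → 0 ≤ W t := fun t ht => hW0 ▸ hWmono ht
  obtain ⟨v, hv0, hvD, hvR, hvL, hvI⟩ := (hC.isSweepingData hu₀ hu₀R
    e.symm.monotone e.apply_symm_apply).exists_path hη
    (u₀ := u₀) (by simpa only [he0] using hu₀) (by
      intro σ hσ
      refine le_trans ?_ hR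
      have h0 : 0 ≤ e.symm σ := he0 ▸ e.symm.monotone hσ
      gcongr
      simp only [he0, intervalIntegral.integral_same, sub_zero]
      rw [intervalIntegral.integral_of_le h0]
      exact setIntegral_le_integral hC.integrable_a (Eventually.of_forall hC.nonneg))
  have hR0 : 0 ≤ R := (norm_nonneg _).trans hu₀R
  have hlip : LipschitzWith (2 * (R + 2)).toNNReal fun σ => v (max σ 0) := by
    refine LipschitzWith.of_dist_le_mul fun σ τ => ?_
    rw [Real.coe_toNNReal _ (by positivity)]
    wlog hστ : σ ≤ τ generalizing σ τ
    · rw [dist_comm, dist_comm σ]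
      exact this τ σ (le_of_not_ge hστ)
    rw [dist_comm, dist_eq_norm]
    refine (hvL _ _ (le_max_right _ _) (max_le_max_right 0 hστ)).trans ?_
    gcongr
    rw [dist_comm, Real.dist_eq]
    exact (le_abs_self _).trans (abs_max_sub_max_le_abs _ _ _)
  obtain ⟨g, hg, hgu⟩ := exists_integrable_density_of_lipschitzWith hlip (W T)
  have hmax : ∀ t, 0 ≤ t → v (max (W t) 0) = v (W t) := fun t ht => by
    rw [max_eq_left (hWpos t ht)]
  refine ⟨fun t => v (max (W t) 0), fun t => (1 + φ t) • g (W t),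
    integrable_smul_comp_timeChange hC.integrable hC.phi_nonneg hg, ?_, ?_, fun t =>
    hvR _ (le_max_right _ _), hlip.continuous.comp (continuous_timeChange hC.integrable), ?_, ?_⟩
  · intro t ht
    rw [integral_smul_comp_timeChange hC.integrable hC.phi_nonneg g ht.1, ← hW, hW0]
    have := hgu (W t) ⟨hWpos t ht.1, hWmono ht.2⟩
    rwa [max_self, hv0] at this
  · intro t ht
    have := hvD _ (hWpos t ht)
    simp only [he] at this
    simpa only [hmax t ht] using this
  · intro s t hst
    have := hlip.dist_le_mul (W t) (W s)
    rwa [dist_eq_norm, Real.dist_eq, abs_of_nonneg (sub_nonneg.mpr (hWmono hst)),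
      Real.coe_toNNReal _ (by positivity)] at this
  · intro s t hs hst hη4 z hz
    have := hvI (W s) (W t) (hWpos s hs) (hWmono hst) hη4 z (by simpa only [he] using hz)
    simp only [he, hvR _ (hWpos s hs), if_true] at this
    simpa only [hmax s hs, hmax t (hs.trans hst)] using this

end IsPerturbedData

end Path

section Existence

namespace IsPerturbedData

variable {H : Type*} [NormedAddCommGroup H] [InnerProductSpace ℝ H]
variable {η R : ℝ} {C : ℝ → Set H} {f : ℝ → H → H} {a φ : ℝ → ℝ}

theorem integrable_comp (hC : IsPerturbedData η R C f a φ) {u : ℝ → H} (hu : Continuous u)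
    (huR : ∀ t, ‖u t‖ ≤ R) {s : ℝ} {x : H} (hx : x ∈ C s) (hxR : ‖x‖ ≤ R) :
    Integrable fun t => f t (u t) := by
  have h1 : StronglyMeasurable (Function.uncurry fun s t => f t (u s)) :=
    stronglyMeasurable_uncurry_of_continuous_of_stronglyMeasurable
      (fun t => (hC.continuous t).comp hu) (fun s => hC.stronglyMeasurable (u s))
  have h2 : StronglyMeasurable fun t => f t (u t) :=
    h1.comp_measurable (measurable_id.prodMk measurable_id)
  refine ((hC.integrable_a.mul_const (1 + ‖x‖)).add (hC.integrable.mul_const (R + R))).mono'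
    h2.aestronglyMeasurable (Eventually.of_forall fun t => ?_)
  have hφ := hC.phi_nonneg t
  calc ‖f t (u t)‖ = ‖f t x + (f t (u t) - f t x)‖ := by congr 1; abel
    _ ≤ a t * (1 + ‖x‖) + φ t * ‖u t - x‖ := (norm_add_le _ _).trans
      (add_le_add (hC.norm_le t s x hx) (hC.norm_sub_le t _ x (huR t) hxR))
    _ ≤ a t * (1 + ‖x‖) + φ t * (R + R) := by
      gcongr
      exact (_root_.norm_sub_le _ _).trans (add_le_add (huR t) hxR)

theorem mem_proxNormalCone_of_hasDerivAt (hη : 0 < η) (hC : IsPerturbedData η R C f a φ)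
    {u : ℝ → H} {t : ℝ} (ht : 0 < t) (hut : u t ∈ C t) (huR : ∀ t, ‖u t‖ ≤ R)
    (huL : ∀ s t, s ≤ t → ‖u t - u s‖ ≤ 2 * (R + 2) * (timeChange φ t - timeChange φ s))
    (huI : ∀ s t, 0 ≤ s → s ≤ t → timeChange φ t - timeChange φ s ≤ η / 4 → ∀ z ∈ C t,
        ⟪u s - u t + ∫ r in s..t, f r (u s), z - u t⟫ ≤
          IsCatchingUp.const η R * (timeChange φ t - timeChange φ s) *
            (‖z - u t‖ ^ 2 + (timeChange φ t - timeChange φ s)))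
    (hint : ∀ x, ‖x‖ ≤ R → Integrable fun t => f t x) (hfu : Integrable fun r => f r (u r))
    {g : H} (hu' : HasDerivAt u g t) (hf' : HasDerivAt (fun s => ∫ r in (0 : ℝ)..s, f r (u r))
      (f t (u t)) t) (hW' : HasDerivAt (timeChange φ) (1 + φ t) t) :
    f t (u t) - g ∈ proxNormalCone (C t) (u t) := by
  have hR : 0 ≤ R := (norm_nonneg _).trans (huR 0)
  have hA := IsCatchingUp.const_nonneg hη hR
  set A := IsCatchingUp.const η R
  have hφ := hC.phi_nonneg t
  set W := timeChange φ
  refine mem_proxNormalCone_of_inner_le (c := A * (1 + φ t) + 1) (by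
    have : 0 ≤ A * (1 + φ t) := mul_nonneg hA (add_nonneg zero_le_one hφ)
    linarith) hut fun z hz => ?_
  suffices h : ⟪f t (u t) - g, z - u t⟫ ≤ A * (1 + φ t) * ‖z - u t‖ ^ 2 by
    linarith [sq_nonneg ‖z - u t‖]
  have hmono : 𝓝[<] t ≤ 𝓝[≠] t := nhdsWithin_mono t fun s hs => ne_of_lt hs
  have hus := (hasDerivAt_iff_tendsto_slope.mp hu').mono_left hmono
  have hfs := (hasDerivAt_iff_tendsto_slope.mp hf').mono_left hmono
  have hWs := (hasDerivAt_iff_tendsto_slope.mp hW').mono_left hmono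
  have hδ : Tendsto (fun s => W t - W s) (𝓝[<] t) (𝓝 0) := by
    have := (hW'.continuousAt.tendsto.mono_left (nhdsWithin_le_nhds (s := Iio t))).const_sub (W t)
    rwa [sub_self] at this
  have hlim1 := (hfs.sub hus).inner (𝕜 := ℝ) (tendsto_const_nhds (x := z - u t))
  have hlim2 := ((hWs.const_mul A).mul (hδ.const_add (‖z - u t‖ ^ 2))).add
    ((hWs.mul (hδ.const_mul (2 * (R + 2)))).mul_const ‖z - u t‖)
  rw [add_zero, mul_zero, mul_zero, zero_mul, add_zero] at hlim2
  refine le_of_tendsto_of_tendsto hlim1 hlim2 ?_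
  filter_upwards [self_mem_nhdsWithin, hδ.eventually (gt_mem_nhds (show 0 < η / 4 by linarith)),
    mem_nhdsWithin_of_mem_nhds (lt_mem_nhds ht)] with s hst hsη hs0
  rw [mem_Iio] at hst
  have hst' : 0 < t - s := sub_pos.mpr hst
  have hWst : 0 ≤ W t - W s :=
    hst'.le.trans (sub_le_timeChange_sub hC.integrable hC.phi_nonneg hst.le)
  have h1 := huI s t hs0.le hst.le hsη.le z hz
  have h2 := hC.norm_integral_sub_le hst.le hfu (hint (u s) (huR s))
    (c := 2 * (R + 2) * (W t - W s)) (fun r hr => by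
      refine (hC.norm_sub_le r _ _ (huR r) (huR s)).trans ?_
      refine mul_le_mul_of_nonneg_left ((huL s r hr.1.le).trans ?_) (hC.phi_nonneg r)
      have := (strictMono_timeChange hC.integrable hC.phi_nonneg).monotone hr.2
      gcongr) (by positivity)
  have h3 : ⟪u s - u t + ∫ r in s..t, f r (u r), z - u t⟫ ≤
      A * (W t - W s) * (‖z - u t‖ ^ 2 + (W t - W s)) +
        (W t - W s) * (2 * (R + 2) * (W t - W s)) * ‖z - u t‖ := by
    have h4 := (real_inner_le_norm _ (z - u t)).trans (mul_le_mul_of_nonneg_right h2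
      (norm_nonneg (z - u t)))
    have h5 : u s - u t + ∫ r in s..t, f r (u r) = (u s - u t + ∫ r in s..t, f r (u s)) +
        ((∫ r in s..t, f r (u r)) - ∫ r in s..t, f r (u s)) := by abel
    rw [h5, inner_add_left]
    exact add_le_add h1 h4
  have hslope : ∀ F : ℝ → H, slope F t s = (t - s)⁻¹ • (F t - F s) := fun F => by
    rw [slope_comm, slope_def_module]
  have hfint : (∫ r in (0 : ℝ)..t, f r (u r)) - ∫ r in (0 : ℝ)..s, f r (u r) =
      ∫ r in s..t, f r (u r) :=
    intervalIntegral.integral_interval_sub_left hfu.intervalIntegrable hfu.intervalIntegrable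
  have hWslope : slope W t s = (t - s)⁻¹ * (W t - W s) := by
    rw [slope_comm, slope_def_module, smul_eq_mul]
  have h6 : slope (fun s => ∫ r in (0 : ℝ)..s, f r (u r)) t s - slope u t s =
      (t - s)⁻¹ • (u s - u t + ∫ r in s..t, f r (u r)) := by
    rw [hslope, hslope, hfint, ← smul_sub]
    congr 1
    abel
  rw [h6, hWslope, real_inner_smul_left]
  calc _ ≤ (t - s)⁻¹ * (A * (W t - W s) * (‖z - u t‖ ^ 2 + (W t - W s)) +
        (W t - W s) * (2 * (R + 2) * (W t - W s)) * ‖z - u t‖) := by gcongr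
    _ = _ := by ring

theorem exists_isSweepingSol [CompleteSpace H] (hη : 0 < η) (hC : IsPerturbedData η R C f a φ)
    {u₀ : H} (hu₀ : u₀ ∈ C 0) (hR : (1 + ‖u₀‖) * Real.exp (3 * ∫ r, a r) ≤ 1 + R) (T : ℝ) :
    ∃ u : ℝ → H, IsSweepingSol C f T u₀ u := by
  obtain ⟨u, g, hg, hug, huC, huR, huc, huL, huI⟩ := hC.exists_path hη hu₀ hR T
  refine ⟨u, g, hg.integrableOn, hug, fun t ht => huC t ht.1, ?_⟩
  have hu0C := huC 0 le_rfl
  have hfu := hC.integrable_comp huc huR hu0C (huR 0)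
  rw [← restrict_Ioo_eq_restrict_Icc, ae_restrict_iff' measurableSet_Ioo]
  filter_upwards [LocallyIntegrable.ae_hasDerivAt_integral hg.locallyIntegrable,
    LocallyIntegrable.ae_hasDerivAt_integral hfu.locallyIntegrable,
    LocallyIntegrable.ae_hasDerivAt_integral hC.integrable.locallyIntegrable] with t hg' hf' hφ' ht
  refine mem_proxNormalCone_of_hasDerivAt hη hC ht.1 (huC t ht.1.le) huR huL huI
    (fun x hx => hC.integrable_apply hu0C (huR 0) hx) hfu ?_ (hf' 0) ((hasDerivAt_id t).add (hφ' 0))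
  refine ((hg' 0).const_add u₀).congr_of_eventuallyEq ?_
  filter_upwards [Ioo_mem_nhds ht.1 ht.2] with s hs
  exact hug s (Ioo_subset_Icc_self hs)

end IsPerturbedData

end Existence

section Uniqueness

variable {H : Type*} [NormedAddCommGroup H]

theorem AbsolutelyContinuousOnInterval.of_dist_le {X Y : Type*} [PseudoMetricSpace X]
    [PseudoMetricSpace Y] {F : ℝ → X} {G : ℝ → Y} {a b : ℝ}
    (hG : AbsolutelyContinuousOnInterval G a b)
    (h : ∀ s ∈ uIcc a b, ∀ t ∈ uIcc a b, dist (F s) (F t) ≤ dist (G s) (G t)) :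
    AbsolutelyContinuousOnInterval F a b := by
  rw [absolutelyContinuousOnInterval_iff] at hG ⊢
  intro ε hε
  obtain ⟨δ, hδ, hG⟩ := hG ε hε
  refine ⟨δ, hδ, fun E hE hEδ => (Finset.sum_le_sum fun i hi => ?_).trans_lt (hG E hE hEδ)⟩
  exact h _ (hE.1 i hi).1 _ (hE.1 i hi).2

theorem dist_integral_le_dist_integral_norm [NormedSpace ℝ H] {g : ℝ → H} (hg : Integrable g)
    (s t : ℝ) : dist (∫ r in (0 : ℝ)..s, g r) (∫ r in (0 : ℝ)..t, g r) ≤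
      dist (∫ r in (0 : ℝ)..s, ‖g r‖) (∫ r in (0 : ℝ)..t, ‖g r‖) := by
  rw [dist_eq_norm, dist_eq_norm, Real.norm_eq_abs,
    intervalIntegral.integral_interval_sub_left hg.intervalIntegrable hg.intervalIntegrable,
    intervalIntegral.integral_interval_sub_left hg.norm.intervalIntegrable
      hg.norm.intervalIntegrable]
  exact intervalIntegral.norm_integral_le_abs_integral_norm

theorem dist_exp_neg_le {x y : ℝ} (hx : 0 ≤ x) (hy : 0 ≤ y) :
    dist (Real.exp (-x)) (Real.exp (-y)) ≤ dist x y := by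
  wlog hxy : x ≤ y generalizing x y
  · rw [dist_comm, dist_comm x]
    exact this hy hx (le_of_not_ge hxy)
  rw [Real.dist_eq, Real.dist_eq, abs_sub_comm x, abs_of_nonneg (sub_nonneg.mpr hxy),
    abs_of_nonneg (sub_nonneg.mpr (Real.exp_le_exp.mpr (neg_le_neg hxy)))]
  have h1 : Real.exp (-y) = Real.exp (-x) * Real.exp (x - y) := by
    rw [← Real.exp_add]
    ring_nf
  have h2 := Real.add_one_le_exp (x - y)
  have h3 : Real.exp (-x) ≤ 1 := Real.exp_le_one_iff.mpr (neg_nonpos.mpr hx)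
  rw [h1]
  nlinarith [Real.exp_pos (-x)]

/-- A Gronwall lemma for absolutely continuous curves in an inner product space. -/
theorem integral_eq_zero_of_inner_le [InnerProductSpace ℝ H] [CompleteSpace H] {g : ℝ → H}
    {c : ℝ → ℝ} {T : ℝ} (hg : Integrable g) (hc : Integrable c) (hc0 : 0 ≤ c)
    (h : ∀ᵐ t, t ∈ Icc 0 T → 2 * ⟪∫ r in (0 : ℝ)..t, g r, g t⟫ ≤
      c t * ‖∫ r in (0 : ℝ)..t, g r‖ ^ 2) {t : ℝ} (ht : t ∈ Icc 0 T) :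
    ∫ r in (0 : ℝ)..t, g r = 0 := by
  set e : ℝ → H := fun t => ∫ r in (0 : ℝ)..t, g r
  set E : ℝ → ℝ := fun t => Real.exp (-∫ r in (0 : ℝ)..t, c r)
  have hprim : ∀ {k : ℝ → ℝ}, Integrable k →
      AbsolutelyContinuousOnInterval (fun t => ∫ r in (0 : ℝ)..t, k r) 0 t := fun hk =>
    hk.intervalIntegrable.absolutelyContinuousOnInterval_intervalIntegral left_mem_uIcc
  have hnorm : AbsolutelyContinuousOnInterval (fun t => ‖e t‖) 0 t :=
    (hprim hg.norm).of_dist_le fun r _ s _ =>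
      (dist_norm_norm_le _ _).trans_eq (dist_eq_norm _ _).symm |>.trans
        (dist_integral_le_dist_integral_norm hg r s)
  have hE : AbsolutelyContinuousOnInterval E 0 t := by
    refine (hprim hc).of_dist_le fun r hr s hs => ?_
    rw [uIcc_of_le ht.1] at hr hs
    exact dist_exp_neg_le
      (intervalIntegral.integral_nonneg_of_forall hr.1 hc0)
      (intervalIntegral.integral_nonneg_of_forall hs.1 hc0)
  have hψ := ((hnorm.mul hnorm).mul hE).integral_deriv_eq_sub
  have hle : ∫ s in (0 : ℝ)..t, deriv ((fun t => ‖e t‖) * (fun t => ‖e t‖) * E) s ≤ 0 := by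
    rw [intervalIntegral.integral_of_le ht.1]
    refine integral_nonpos_of_ae ?_
    rw [EventuallyLE, ae_restrict_iff' measurableSet_Ioc]
    filter_upwards [h, LocallyIntegrable.ae_hasDerivAt_integral hg.locallyIntegrable,
      LocallyIntegrable.ae_hasDerivAt_integral hc.locallyIntegrable] with s hs hgs hcs hst
    have hd : HasDerivAt ((fun t => ‖e t‖) * (fun t => ‖e t‖) * E)
        (2 * ⟪e s, g s⟫ * E s + ‖e s‖ ^ 2 * (E s * -c s)) s := by
      have := (hgs 0).norm_sq.mul (hcs 0).neg.exp
      refine this.congr_of_eventuallyEq (Eventually.of_forall fun r => ?_)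
      simp only [Pi.mul_apply, ← sq]
      rfl
    rw [hd.deriv]
    have h1 := hs ⟨hst.1.le, hst.2.trans ht.2⟩
    have h2 : 0 ≤ E s := (Real.exp_pos _).le
    simp only [Pi.zero_apply]
    nlinarith [mul_le_mul_of_nonneg_right h1 h2]
  rw [hψ] at hle
  have he0 : e 0 = 0 := intervalIntegral.integral_same
  simp only [Pi.mul_apply, he0, norm_zero, mul_zero, zero_mul, sub_zero] at hle
  have h2 : 0 < E t := Real.exp_pos _
  have h3 : ‖e t‖ * ‖e t‖ ≤ 0 := nonpos_of_mul_nonpos_left hle h2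
  exact norm_eq_zero.mp (mul_self_eq_zero.mp (h3.antisymm (mul_self_nonneg _)))

end Uniqueness

section EqOn

variable {H : Type*} [NormedAddCommGroup H] [InnerProductSpace ℝ H]
variable {η : ℝ} {C : ℝ → Set H} {f : ℝ → H → H} {T : ℝ} {u₀ : H} {β : ℝ → ℝ}

theorem ProxRegular.two_mul_inner_sub_le {S : Set H} (hη : 0 < η) (hS : ProxRegular η S)
    {x y p q a b : H} (hx : x ∈ S) (hy : y ∈ S) (hp : p - a ∈ proxNormalCone S x)
    (hq : q - b ∈ proxNormalCone S y) {k d : ℝ} (hk : ‖p - q‖ ≤ k * ‖x - y‖)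
    (hd : ‖p - a‖ + ‖q - b‖ ≤ d) :
    2 * ⟪x - y, a - b⟫ ≤ (2 * k + η⁻¹ * d) * ‖x - y‖ ^ 2 := by
  have h1 := hS.inner_le hη hx hp hy
  have h2 := hS.inner_le hη hy hq hx
  have h3 : ⟪p - q, x - y⟫ ≤ k * ‖x - y‖ ^ 2 := by
    calc _ ≤ ‖p - q‖ * ‖x - y‖ := real_inner_le_norm _ _
      _ ≤ k * ‖x - y‖ * ‖x - y‖ := by gcongr
      _ = _ := by ring
  have h4 : ⟪x - y, a - b⟫ = ⟪p - q, x - y⟫ + ⟪p - a, y - x⟫ + ⟪q - b, x - y⟫ := by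
    rw [real_inner_comm, ← neg_sub x y, inner_neg_right, ← sub_eq_add_neg, ← inner_sub_left,
      ← inner_add_left]
    congr 1
    abel
  rw [norm_sub_rev y x] at h1
  have h5 : (‖p - a‖ + ‖q - b‖) * (η⁻¹ * ‖x - y‖ ^ 2) ≤ d * (η⁻¹ * ‖x - y‖ ^ 2) := by gcongr
  have h6 : ∀ r, 2 * (r / (2 * η) * ‖x - y‖ ^ 2) = r * (η⁻¹ * ‖x - y‖ ^ 2) := fun r => by
    field_simp
  have h7 := h6 ‖p - a‖
  have h8 := h6 ‖q - b‖
  linarith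

theorem intervalIntegral_indicator_Icc {g : ℝ → H} {t : ℝ} (ht : t ∈ Icc 0 T) :
    ∫ r in (0 : ℝ)..t, (Icc 0 T).indicator g r = ∫ r in (0 : ℝ)..t, g r := by
  refine intervalIntegral.integral_congr fun r hr => ?_
  rw [uIcc_of_le ht.1] at hr
  exact indicator_of_mem (show r ∈ Icc 0 T from ⟨hr.1, hr.2.trans ht.2⟩) g

theorem norm_intervalIntegral_le_setIntegral {g : ℝ → H} (hg : IntegrableOn g (Icc 0 T)) {t : ℝ}
    (ht : t ∈ Icc 0 T) : ‖∫ r in (0 : ℝ)..t, g r‖ ≤ ∫ r in Icc 0 T, ‖g r‖ := by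
  rw [intervalIntegral.integral_of_le ht.1]
  refine (norm_integral_le_integral_norm _).trans (setIntegral_mono_set hg.norm
    (Eventually.of_forall fun r => norm_nonneg _) (LE.le.eventuallyLE ?_))
  exact fun r hr => ⟨hr.1.le, hr.2.trans ht.2⟩

theorem IsSweepingSol.eqOn [CompleteSpace H] (hη : 0 < η)
    (hC : ∀ t ∈ Icc 0 T, ProxRegular η (C t)) (hβ : ∀ t, 0 ≤ β t)
    (hβint : IntegrableOn β (Icc 0 T))
    (hgrowth : ∀ t ∈ Icc 0 T, ∀ x ∈ C t, ‖f t x‖ ≤ β t * (1 + ‖x‖))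
    (hLip : ∀ M : ℝ, 0 < M → ∃ k : ℝ → ℝ, (∀ t, 0 ≤ k t) ∧ IntegrableOn k (Icc 0 T) ∧
      ∀ t ∈ Icc 0 T, ∀ x ∈ Metric.ball (0 : H) M, ∀ y ∈ Metric.ball (0 : H) M,
        ‖f t x - f t y‖ ≤ k t * ‖x - y‖)
    {u v : ℝ → H} (hu : IsSweepingSol C f T u₀ u) (hv : IsSweepingSol C f T u₀ v) :
    EqOn u v (Icc 0 T) := by
  obtain ⟨g, hg, hug, huC, hu⟩ := hu
  obtain ⟨l, hl, hvl, hvC, hv⟩ := hv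
  set M : ℝ := ‖u₀‖ + (∫ r in Icc 0 T, ‖g r‖) + (∫ r in Icc 0 T, ‖l r‖) + 1
  have hg0 : 0 ≤ ∫ r in Icc 0 T, ‖g r‖ := integral_nonneg fun r => norm_nonneg _
  have hl0 : 0 ≤ ∫ r in Icc 0 T, ‖l r‖ := integral_nonneg fun r => norm_nonneg _
  have hM : 0 < M := by positivity
  have huM : ∀ t ∈ Icc 0 T, ‖u t‖ < M := fun t ht => by
    rw [hug t ht]
    linarith [norm_add_le u₀ (∫ s in (0 : ℝ)..t, g s), norm_intervalIntegral_le_setIntegral hg ht]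
  have hvM : ∀ t ∈ Icc 0 T, ‖v t‖ < M := fun t ht => by
    rw [hvl t ht]
    linarith [norm_add_le u₀ (∫ s in (0 : ℝ)..t, l s), norm_intervalIntegral_le_setIntegral hl ht]
  obtain ⟨k, hk, hkint, hfk⟩ := hLip M hM
  set G := (Icc 0 T).indicator g
  set L := (Icc 0 T).indicator l
  have hG : Integrable G := hg.integrable_indicator measurableSet_Icc
  have hL : Integrable L := hl.integrable_indicator measurableSet_Icc
  have hdiff : ∀ t ∈ Icc 0 T, ∫ r in (0 : ℝ)..t, (G - L) r = u t - v t := fun t ht => by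
    simp only [Pi.sub_apply]
    rw [intervalIntegral.integral_sub hG.intervalIntegrable hL.intervalIntegrable,
      intervalIntegral_indicator_Icc ht, intervalIntegral_indicator_Icc ht, hug t ht, hvl t ht]
    abel
  set d : ℝ → ℝ := fun t => β t * (1 + M) + ‖g t‖ + (β t * (1 + M) + ‖l t‖)
  have hd : IntegrableOn d (Icc 0 T) := by
    have := hβint.mul_const (1 + M)
    exact (this.add hg.norm).add (this.add hl.norm)
  have hc : Integrable ((Icc 0 T).indicator fun t => 2 * k t + η⁻¹ * d t) :=
    IntegrableOn.integrable_indicator ((hkint.const_mul 2).add (hd.const_mul η⁻¹)) measurableSet_Icc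
  have hc0 : 0 ≤ (Icc 0 T).indicator fun t => 2 * k t + η⁻¹ * d t := fun t =>
    indicator_nonneg (fun t _ => by
      have := hk t
      have := hβ t
      positivity) t
  intro t ht
  rw [← sub_eq_zero, ← hdiff t ht]
  refine integral_eq_zero_of_inner_le (hG.sub hL) hc hc0 ?_ ht
  rw [ae_restrict_iff' measurableSet_Icc] at hu hv
  filter_upwards [hu, hv] with s hus hvs hs
  have hGs : G s = g s := indicator_of_mem hs g
  have hLs : L s = l s := indicator_of_mem hs l
  rw [hdiff s hs, indicator_of_mem hs, Pi.sub_apply, hGs, hLs]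
  have hf : ∀ x ∈ C s, ‖x‖ < M → ‖f s x‖ ≤ β s * (1 + M) := fun x hx hxM => by
    have := hβ s
    exact (hgrowth s hs x hx).trans (by gcongr)
  refine (hC s hs).two_mul_inner_sub_le hη (huC s hs) (hvC s hs) (hus hs) (hvs hs)
    (hfk s hs _ (mem_ball_zero_iff.mpr (huM s hs)) _ (mem_ball_zero_iff.mpr (hvM s hs))) ?_
  exact add_le_add
    ((norm_sub_le _ _).trans (add_le_add_left (hf _ (huC s hs) (huM s hs)) _))
    ((norm_sub_le _ _).trans (add_le_add_left (hf _ (hvC s hs) (hvM s hs)) _))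

end EqOn

section Extension

variable {H : Type*} [NormedAddCommGroup H] [InnerProductSpace ℝ H]
variable {η : ℝ} {C : ℝ → Set H} {f : ℝ → H → H} {T : ℝ} {u₀ : H} {w β k : ℝ → ℝ}

theorem IsAbsContOn.abs_sub_le {l : ℝ → ℝ} (hl : IntegrableOn l (Icc 0 T))
    (hw : ∀ t ∈ Icc 0 T, w t = w 0 + ∫ r in (0 : ℝ)..t, l r) {a : ℝ → ℝ} (ha : Integrable a)
    (hla : ∀ t ∈ Icc 0 T, |l t| ≤ a t) {s t : ℝ} (hs : 0 ≤ s) (hst : s ≤ t)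
    (ht : t ≤ T) : |w t - w s| ≤ ∫ r in s..t, a r := by
  have hint : ∀ r ∈ Icc 0 T, IntervalIntegrable l volume 0 r := fun r hr =>
    (intervalIntegrable_iff_integrableOn_Icc_of_le hr.1).mpr
      (hl.mono_set (Icc_subset_Icc_right hr.2))
  rw [hw t ⟨hs.trans hst, ht⟩, hw s ⟨hs, hst.trans ht⟩, add_sub_add_left_eq_sub,
    intervalIntegral.integral_interval_sub_left (hint t ⟨hs.trans hst, ht⟩)
      (hint s ⟨hs, hst.trans ht⟩), ← Real.norm_eq_abs]
  exact intervalIntegral.norm_integral_le_of_norm_le hst (Eventually.of_forall fun r hr =>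
    hla r ⟨hs.trans hr.1.le, hr.2.trans ht⟩) ha.intervalIntegrable

/-- Sweeping data on `[0, T]` extend to the whole line, by freezing the moving set and killing the
perturbation outside `[0, T]`. -/
theorem isPerturbedData_extend (hT : 0 ≤ T) (hCclosed : ∀ t ∈ Icc 0 T, IsClosed (C t))
    (hCne : ∀ t ∈ Icc 0 T, (C t).Nonempty) (hCprox : ∀ t ∈ Icc 0 T, ProxRegular η (C t))
    {l : ℝ → ℝ} (hl : IntegrableOn l (Icc 0 T))
    (hw : ∀ t ∈ Icc 0 T, w t = w 0 + ∫ r in (0 : ℝ)..t, l r)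
    (hCvar : ∀ y : H, ∀ s ∈ Icc 0 T, ∀ t ∈ Icc 0 T,
      |Metric.infDist y (C t) - Metric.infDist y (C s)| ≤ |w t - w s|)
    (hfmeas : ∀ x : H, StronglyMeasurable fun t => f t x)
    (hfcont : ∀ t ∈ Icc 0 T, Continuous (f t))
    (hβ : ∀ t, 0 ≤ β t) (hβint : IntegrableOn β (Icc 0 T))
    (hgrowth : ∀ t ∈ Icc 0 T, ∀ x ∈ ⋃ s ∈ Icc 0 T, C s, ‖f t x‖ ≤ β t * (1 + ‖x‖))
    {R : ℝ} (hk : ∀ t, 0 ≤ k t) (hkint : IntegrableOn k (Icc 0 T))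
    (hfk : ∀ t ∈ Icc 0 T, ∀ x ∈ Metric.ball (0 : H) (R + 1), ∀ y ∈ Metric.ball (0 : H) (R + 1),
      ‖f t x - f t y‖ ≤ k t * ‖x - y‖) :
    IsPerturbedData η R (fun t => C (projIcc 0 T hT t)) (fun t x => (Icc 0 T).indicator (f · x) t)
      ((Icc 0 T).indicator fun t => |l t| + β t)
      ((Icc 0 T).indicator fun t => |l t| + β t + k t) := by
  have hlβ : IntegrableOn (fun t => |l t| + β t) (Icc 0 T) := hl.abs.add hβint
  have ha : Integrable ((Icc 0 T).indicator fun t => |l t| + β t) :=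
    hlβ.integrable_indicator measurableSet_Icc
  have ha0 : 0 ≤ (Icc 0 T).indicator fun t => |l t| + β t :=
    fun t => indicator_nonneg (fun t _ => add_nonneg (abs_nonneg _) (hβ t)) t
  refine ⟨fun t => hCclosed _ (projIcc 0 T hT t).2, fun t => hCne _ (projIcc 0 T hT t).2,
    fun t => hCprox _ (projIcc 0 T hT t).2, ha0,
    fun t => indicator_le_indicator (le_add_of_nonneg_right (hk t)), ha,
    (IntegrableOn.add hlβ hkint).integrable_indicator measurableSet_Icc, ?_,
    fun x => (hfmeas x).indicator measurableSet_Icc, ?_, ?_, ?_⟩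
  · intro s t hst y
    refine (hCvar y _ (projIcc 0 T hT s).2 _ (projIcc 0 T hT t).2).trans ?_
    have hmono := monotone_projIcc hT hst
    refine (IsAbsContOn.abs_sub_le hl hw ha (fun r hr => ?_) (projIcc 0 T hT s).2.1 hmono
      (projIcc 0 T hT t).2.2).trans ?_
    · rw [indicator_of_mem hr]
      exact le_add_of_nonneg_right (hβ r)
    · rw [intervalIntegral.integral_of_le hmono, intervalIntegral.integral_of_le hst,
        setIntegral_indicator measurableSet_Icc, setIntegral_indicator measurableSet_Icc]
      refine setIntegral_mono_set (hlβ.mono_set inter_subset_right)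
        (Eventually.of_forall fun t => add_nonneg (abs_nonneg _) (hβ t)) (LE.le.eventuallyLE ?_)
      rintro r ⟨⟨h1, h2⟩, h3⟩
      rw [coe_projIcc] at h1 h2
      rw [max_lt_iff, min_lt_iff] at h1
      rw [le_max_iff, le_min_iff] at h2
      refine ⟨⟨h1.2.resolve_left h3.2.not_gt, ?_⟩, h3⟩
      exact h2.elim (fun h => absurd h h1.1.not_ge) And.right
  · intro t
    by_cases ht : t ∈ Icc 0 T
    · simpa only [indicator_of_mem ht] using hfcont t ht
    · simpa only [indicator_of_notMem ht] using continuous_const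
  · intro t s x hx
    by_cases ht : t ∈ Icc 0 T
    · rw [indicator_of_mem ht, indicator_of_mem ht]
      refine (hgrowth t ht x (mem_iUnion₂.mpr ⟨_, (projIcc 0 T hT s).2, hx⟩)).trans ?_
      gcongr
      exact le_add_of_nonneg_left (abs_nonneg _)
    · simp [indicator_of_notMem ht]
  · intro t x y hx hy
    by_cases ht : t ∈ Icc 0 T
    · rw [indicator_of_mem ht, indicator_of_mem ht, indicator_of_mem ht]
      refine (hfk t ht x (mem_ball_zero_iff.mpr (by linarith)) y
        (mem_ball_zero_iff.mpr (by linarith))).trans ?_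
      gcongr
      exact le_add_of_nonneg_left (add_nonneg (abs_nonneg _) (hβ t))
    · simp [indicator_of_notMem ht]

theorem IsSweepingSol.congr [CompleteSpace H] {C' : ℝ → Set H} {f' : ℝ → H → H} {u : ℝ → H}
    (hu : IsSweepingSol C f T u₀ u) (hC : ∀ t ∈ Icc 0 T, C t = C' t)
    (hf : ∀ t ∈ Icc 0 T, f t = f' t) : IsSweepingSol C' f' T u₀ u := by
  obtain ⟨g, hg, hug, huC, hu⟩ := hu
  refine ⟨g, hg, hug, fun t ht => hC t ht ▸ huC t ht, ?_⟩
  filter_upwards [hu, ae_restrict_mem measurableSet_Icc] with t h ht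
  rwa [← hC t ht, ← hf t ht]

end Extension

/-- **Edmond–Thibault theorem.** Existence and uniqueness of the sweeping process
`u̇(t) + N(C(t),u(t)) ∋ f(t,u(t))`, `u(0) = u₀`, for a moving closed `η`-prox-regular
set `C(·)` varying in an absolutely continuous way, with a perturbation `f` measurable in
time, continuous in space, of linear growth and locally Lipschitz in space. -/
theorem sweeping_process_existence_uniqueness_hilbert_moving
    {H : Type*} [NormedAddCommGroup H] [InnerProductSpace ℝ H] [CompleteSpace H]
    (η : ℝ) (hη : 0 < η) (T : ℝ) (hT : 0 < T)
    (C : ℝ → Set H)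
    (hCclosed : ∀ t ∈ Set.Icc (0:ℝ) T, IsClosed (C t))
    (hCne : ∀ t ∈ Set.Icc (0:ℝ) T, (C t).Nonempty)
    (hCprox : ∀ t ∈ Set.Icc (0:ℝ) T, ProxRegular η (C t))
    -- `C(·)` varies in an absolutely continuous way
    (w : ℝ → ℝ) (hw : IsAbsContOn w 0 T)
    (hCvar : ∀ y : H, ∀ s ∈ Set.Icc (0:ℝ) T, ∀ t ∈ Set.Icc (0:ℝ) T,
      |Metric.infDist y (C t) - Metric.infDist y (C s)| ≤ |w t - w s|)
    (f : ℝ → H → H)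
    -- measurability in the first variable, continuity in the second
    (hfmeas : ∀ x : H, StronglyMeasurable fun t => f t x)
    (hfcont : ∀ t ∈ Set.Icc (0:ℝ) T, Continuous (f t))
    -- linear growth along the sets `C(s)`
    (β : ℝ → ℝ) (hβpos : ∀ t, 0 ≤ β t) (hβint : IntegrableOn β (Set.Icc 0 T))
    (hgrowth : ∀ t ∈ Set.Icc (0:ℝ) T, ∀ x ∈ ⋃ s ∈ Set.Icc (0:ℝ) T, C s,
      ‖f t x‖ ≤ β t * (1 + ‖x‖))
    -- local Lipschitz condition in the second variable
    (hLip : ∀ M : ℝ, 0 < M → ∃ k : ℝ → ℝ, (∀ t, 0 ≤ k t) ∧ IntegrableOn k (Set.Icc 0 T) ∧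
      ∀ t ∈ Set.Icc (0:ℝ) T, ∀ x ∈ Metric.ball (0:H) M, ∀ y ∈ Metric.ball (0:H) M,
        ‖f t x - f t y‖ ≤ k t * ‖x - y‖)
    (u₀ : H) (hu₀ : u₀ ∈ C 0) :
    (∃ u : ℝ → H, IsSweepingSol C f T u₀ u) ∧
      ∀ u v : ℝ → H, IsSweepingSol C f T u₀ u → IsSweepingSol C f T u₀ v →
        Set.EqOn u v (Set.Icc 0 T) := by
  refine ⟨?_, fun u v hu hv => hu.eqOn hη hCprox hβpos hβint (fun t ht x hx =>
    hgrowth t ht x (mem_iUnion₂.mpr ⟨t, ht, hx⟩)) hLip hv⟩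
  obtain ⟨l, hl, hw⟩ := hw
  set a : ℝ → ℝ := (Icc 0 T).indicator fun t => |l t| + β t
  have ha : 0 ≤ ∫ r, a r := integral_nonneg fun t =>
    indicator_nonneg (fun t _ => add_nonneg (abs_nonneg _) (hβpos t)) t
  set R : ℝ := (1 + ‖u₀‖) * Real.exp (3 * ∫ r, a r) - 1 with hR
  obtain ⟨k, hk, hkint, hfk⟩ := hLip (R + 1) (by rw [hR, sub_add_cancel]; positivity)
  have hC := isPerturbedData_extend hT.le hCclosed hCne hCprox hl hw hCvar hfmeas hfcont hβpos
    hβint hgrowth hk hkint hfk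
  obtain ⟨u, hu⟩ := hC.exists_isSweepingSol hη (u₀ := u₀) (by simpa using hu₀)
    (by rw [hR, add_sub_cancel]) T
  refine ⟨u, hu.congr (fun t ht => ?_) fun t ht => ?_⟩
  · rw [projIcc_of_mem hT.le ht]
  · simp only [indicator_of_mem ht]
end
end

section
/- Let H be a Hilbert space, C a uniformly prox-regular (η-prox-regular for some η > 0) closed subset of H, and f : I × H → H a mapping satisfying the measurability, continuity, linear growth and Lipschitz assumptions of the Edmond–Thibault theorem. Then for every u₀ ∈ C, the unique absolutely continuous solution u of the sweeping process u̇(t) + N(C,u(t)) ∋ f(t,u(t)), u(0) = u₀, satisfies the differential equation: for almost every t₀ ∈ I, u is differentiable at t₀ and du/dt(t₀) + P_{N(C,u(t₀))}[f(t₀,u(t₀))] = f(t₀,u(t₀)), where P_{N(C,u(t₀))} denotes the (single-valued) metric projection onto the closed convex cone N(C,u(t₀)). -/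
open MeasureTheory Set Filter Topology

noncomputable section

/-- A proximal normal `w` at `x` satisfies, for some `s > 0`, the quadratic inequality
`2 s ⟪w, y - x⟫ ≤ ‖y - x‖²` on `C`. -/
theorem exists_inner_le_of_mem_proxNormalCone
    {H : Type*} [NormedAddCommGroup H] [InnerProductSpace ℝ H] {C : Set H} {x w : H}
    (hw : w ∈ proxNormalCone C x) :
    ∃ s : ℝ, 0 < s ∧ ∀ y ∈ C, 2 * s * inner ℝ w (y - x) ≤ ‖y - x‖ ^ 2 := by
  obtain ⟨s, hs, -, hdist⟩ := hw
  refine ⟨s, hs, fun y hy => ?_⟩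
  have hle : ‖s • w‖ ≤ ‖s • w - (y - x)‖ := by
    calc ‖s • w‖ = ‖x + s • w - x‖ := by rw [add_sub_cancel_left]
      _ = Metric.infDist (x + s • w) C := hdist
      _ ≤ dist (x + s • w) y := Metric.infDist_le_dist_of_mem hy
      _ = ‖s • w - (y - x)‖ := by rw [dist_eq_norm]; congr 1; abel
  have hsq := pow_le_pow_left₀ (norm_nonneg _) hle 2
  rw [norm_sub_sq_real, real_inner_smul_left] at hsq
  linarith

/-- The two-sided derivative of a curve staying in `C` is orthogonal to all proximal normals. -/
theorem inner_eq_zero_of_mem_proxNormalCone_of_hasDerivAt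
    {H : Type*} [NormedAddCommGroup H] [InnerProductSpace ℝ H] {C : Set H}
    {u : ℝ → H} {d w : H} {t₀ : ℝ} (hC : ∀ᶠ t in 𝓝 t₀, u t ∈ C) (hd : HasDerivAt u d t₀)
    (hw : w ∈ proxNormalCone C (u t₀)) : inner ℝ w d = 0 := by
  obtain ⟨s, hs, hle⟩ := exists_inner_le_of_mem_proxNormalCone hw
  have hsub : HasDerivAt (fun t => u t - u t₀) d t₀ := hd.sub_const _
  have hderiv := (((hasDerivAt_const t₀ w).inner ℝ hsub).const_mul (2 * s)).sub hsub.norm_sq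
  have hmax : IsLocalMax ((fun t => 2 * s * inner ℝ w (u t - u t₀)) -
      fun t => ‖u t - u t₀‖ ^ 2) t₀ := by
    filter_upwards [hC] with t ht
    simpa using hle _ ht
  have hzero := hmax.hasDerivAt_eq_zero hderiv
  simpa [hs.ne'] using hzero

/-- If `v ∈ N` and `z - v` is orthogonal to `N`, then `v` is the only projection of `z`
onto `N`. -/
theorem projSet_eq_singleton_of_forall_inner_eq_zero
    {H : Type*} [NormedAddCommGroup H] [InnerProductSpace ℝ H] {N : Set H} {z v : H}
    (hv : v ∈ N) (horth : ∀ w ∈ N, inner ℝ w (z - v) = 0) : projSet N z = {v} := by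
  have hpyth (w : H) (hw : w ∈ N) : ‖z - w‖ ^ 2 = ‖z - v‖ ^ 2 + ‖v - w‖ ^ 2 := by
    have hinner : inner ℝ (z - v) (v - w) = 0 := by
      rw [real_inner_comm, inner_sub_left, horth v hv, horth w hw, sub_zero]
    rw [← sub_add_sub_cancel z v w, norm_add_sq_real, hinner]
    ring
  have hinf : Metric.infDist z N = ‖z - v‖ := by
    refine le_antisymm ?_ ((Metric.le_infDist ⟨v, hv⟩).2 fun w hw => ?_)
    · simpa [dist_eq_norm] using Metric.infDist_le_dist_of_mem (x := z) hv
    · rw [dist_eq_norm]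
      refine le_of_sq_le_sq ?_ (norm_nonneg _)
      linarith [hpyth w hw, sq_nonneg ‖v - w‖]
  ext w
  constructor
  · rintro ⟨hw, hwz⟩
    have hsq := hpyth w hw
    rw [hwz, hinf] at hsq
    have hvw : ‖v - w‖ = 0 := by simpa using hsq
    exact (sub_eq_zero.1 (norm_eq_zero.1 hvw)).symm
  · rintro rfl
    exact ⟨hv, hinf.symm⟩

/-- For a constant uniformly prox-regular set `C` in a Hilbert space, the unique solution
of the sweeping process `u̇(t) + N(C,u(t)) ∋ f(t,u(t))` satisfies, for a.e. `t₀`, the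
differential equation `u̇(t₀) + P_{N(C,u(t₀))}[f(t₀,u(t₀))] = f(t₀,u(t₀))`, the metric
projection onto the closed convex cone `N(C,u(t₀))` being single valued. -/
theorem sweeping_process_differential_equation_constant_set
    {H : Type*} [NormedAddCommGroup H] [InnerProductSpace ℝ H] [CompleteSpace H]
    (η : ℝ) (hη : 0 < η) (T : ℝ) (hT : 0 < T)
    (C : Set H) (hCclosed : IsClosed C) (hCne : C.Nonempty) (hCprox : ProxRegular η C)
    (f : ℝ → H → H)
    (hfmeas : ∀ x : H, StronglyMeasurable fun t => f t x)
    (hfcont : ∀ t ∈ Set.Icc (0:ℝ) T, Continuous (f t))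
    (β : ℝ → ℝ) (hβpos : ∀ t, 0 ≤ β t) (hβint : IntegrableOn β (Set.Icc 0 T))
    (hgrowth : ∀ t ∈ Set.Icc (0:ℝ) T, ∀ x ∈ C, ‖f t x‖ ≤ β t * (1 + ‖x‖))
    (hLip : ∀ M : ℝ, 0 < M → ∃ k : ℝ → ℝ, (∀ t, 0 ≤ k t) ∧ IntegrableOn k (Set.Icc 0 T) ∧
      ∀ t ∈ Set.Icc (0:ℝ) T, ∀ x ∈ Metric.ball (0:H) M, ∀ y ∈ Metric.ball (0:H) M,
        ‖f t x - f t y‖ ≤ k t * ‖x - y‖)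
    (u₀ : H) (hu₀ : u₀ ∈ C)
    (u : ℝ → H) (hu : IsSweepingSol (fun _ => C) f T u₀ u) :
    ∀ᵐ t₀ ∂volume.restrict (Set.Icc (0:ℝ) T),
      ∃ d pw : H, HasDerivAt u d t₀ ∧
        projSet (proxNormalCone C (u t₀)) (f t₀ (u t₀)) = {pw} ∧
        d + pw = f t₀ (u t₀) := by
  obtain ⟨g, hg, hug, huC, hnormal⟩ := hu
  have hgi : IntervalIntegrable g volume 0 T :=
    (intervalIntegrable_iff_integrableOn_Icc_of_le hT.le).2 hg
  rw [ae_restrict_iff' measurableSet_Icc] at hnormal ⊢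
  filter_upwards [hnormal, hgi.ae_hasDerivAt_integral, Measure.ae_ne volume 0,
    Measure.ae_ne volume T] with t hv hint h0 hT' ht
  have hnhds : Icc 0 T ∈ 𝓝 t := Icc_mem_nhds (ht.1.lt_of_ne h0.symm) (ht.2.lt_of_ne hT')
  have hd : HasDerivAt u (g t) t := by
    rw [uIcc_of_le hT.le] at hint
    refine ((hint ht 0 ⟨le_rfl, hT.le⟩).const_add u₀).congr_of_eventuallyEq ?_
    filter_upwards [hnhds] with r hr using hug r hr
  have hC : ∀ᶠ r in 𝓝 t, u r ∈ C := by
    filter_upwards [hnhds] with r hr using huC r hr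
  refine ⟨g t, f t (u t) - g t, hd, ?_, add_sub_cancel _ _⟩
  refine projSet_eq_singleton_of_forall_inner_eq_zero (hv ht) fun w hw => ?_
  rw [sub_sub_cancel]
  exact inner_eq_zero_of_mem_proxNormalCone_of_hasDerivAt hC hd hw
end
end

section
/- Let B be a Banach space and C a closed subset of B. For x ∈ C and v ∈ Γ^r(C,x), one has λv ∈ Γ^r(C,x) for all λ ∈ (0,1). Moreover, if B is uniformly convex, then for all λ ∈ (0,1) the projection is single-valued there: x = P_C(x + λ r v), i.e. x is the unique nearest point of C to x + λ r v. -/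
open MeasureTheory Set Filter Topology

noncomputable section

/-- `Γ^r(C,x) = {v | x ∈ P_C(x + r v)}`, the good directions to project at scale `r`. -/
def gammaSet {E : Type*} [NormedAddCommGroup E] [NormedSpace ℝ E]
    (r : ℝ) (C : Set E) (x : E) : Set E :=
  {v | x ∈ projSet C (x + r • v)}

theorem mem_projSet_iff {E : Type*} [NormedAddCommGroup E] {C : Set E} {y z : E} :
    z ∈ projSet C y ↔ z ∈ C ∧ ∀ c ∈ C, ‖y - z‖ ≤ ‖y - c‖ := by
  refine and_congr_right fun hz => ⟨fun h c hc => ?_, fun h => le_antisymm ?_ ?_⟩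
  · rw [h, ← dist_eq_norm]
    exact Metric.infDist_le_dist_of_mem hc
  · exact (Metric.le_infDist ⟨z, hz⟩).2 fun c hc => dist_eq_norm y c ▸ h c hc
  · rw [← dist_eq_norm]
    exact Metric.infDist_le_dist_of_mem hz

/-- A nearest point of `C` to `x + w` stays nearest along the segment from `x` to `x + w`. -/
theorem mem_projSet_add_smul {E : Type*} [NormedAddCommGroup E] [NormedSpace ℝ E]
    {C : Set E} {x w : E} (h : x ∈ projSet C (x + w)) {t : ℝ} (ht0 : 0 ≤ t) (ht1 : t ≤ 1) :
    x ∈ projSet C (x + t • w) := by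
  rw [mem_projSet_iff] at h ⊢
  refine ⟨h.1, fun c hc => ?_⟩
  have hwc := h.2 c hc
  have hsplit : x + w - c = (x + t • w - c) + (1 - t) • w := by module
  have htri := norm_add_le (x + t • w - c) ((1 - t) • w)
  rw [← hsplit, norm_smul_of_nonneg (sub_nonneg.2 ht1)] at htri
  rw [add_sub_cancel_left] at hwc ⊢
  rw [norm_smul_of_nonneg ht0]
  linarith

theorem projSet_add_smul_eq_singleton {E : Type*} [NormedAddCommGroup E] [NormedSpace ℝ E]
    [StrictConvexSpace ℝ E] {C : Set E} {x w : E} (h : x ∈ projSet C (x + w)) {t : ℝ}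
    (ht0 : 0 < t) (ht1 : t < 1) : projSet C (x + t • w) = {x} := by
  have hx := mem_projSet_add_smul h ht0.le ht1.le
  refine Set.Subset.antisymm (fun z hz => ?_) (Set.singleton_subset_iff.2 hx)
  have hnorm : ‖x + t • w - z‖ = ‖t • w‖ := by
    rw [hz.2, ← hx.2, add_sub_cancel_left]
  have hwz := (mem_projSet_iff.1 h).2 z hz.1
  rw [add_sub_cancel_left] at hwz
  have hsplit : x + w - z = (x + t • w - z) + (1 - t) • w := by module
  have hray : SameRay ℝ (x + t • w - z) ((1 - t) • w) := by
    refine sameRay_iff_norm_add.2 (le_antisymm (norm_add_le _ _) ?_)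
    rw [← hsplit, hnorm, norm_smul_of_nonneg ht0.le, norm_smul_of_nonneg (sub_pos.2 ht1).le]
    linarith
  have hray' : SameRay ℝ (x + t • w - z) (t • w) := by
    refine (hray.trans (SameRay.sameRay_pos_smul_left w (sub_pos.2 ht1)) fun hw => ?_).pos_smul_right ht0
    exact .inr ((smul_eq_zero.1 hw).resolve_left (sub_pos.2 ht1).ne')
  have heq := eq_of_norm_eq_of_norm_add_eq hnorm hray'.norm_add
  rw [add_sub_right_comm, add_eq_right, sub_eq_zero] at heq
  exact heq.symm

/-- In a Banach space, if `v ∈ Γ^r(C,x)` then `λ v ∈ Γ^r(C,x)` for all `λ ∈ (0,1)`, and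
if moreover the space is uniformly convex then `x` is the unique nearest point of `C` to
`x + λ r v`, i.e. `P_C(x + λ r v) = {x}`. -/
theorem gammaSet_smul_mem_and_proj_singleton
    {E : Type*} [NormedAddCommGroup E] [NormedSpace ℝ E]
    (C : Set E) (hC : IsClosed C) (r : ℝ) (hr : 0 < r)
    (x : E) (hx : x ∈ C) (v : E) (hv : v ∈ gammaSet r C x)
    (lam : ℝ) (h0 : 0 < lam) (h1 : lam < 1) :
    lam • v ∈ gammaSet r C x ∧
      (UniformConvexSpace E → projSet C (x + (lam * r) • v) = {x}) := by
  refine ⟨?_, fun _ => ?_⟩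
  · change x ∈ projSet C (x + r • lam • v)
    rw [smul_comm]
    exact mem_projSet_add_smul hv h0.le h1.le
  · rw [mul_smul]
    exact projSet_add_smul_eq_singleton hv h0 h1
end
end
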